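/- For fixed A ≥ 2 and k ≥ 0, as n → ∞, p_k(A;n) ∼ (24^{k/2 − 1/4} (n − Ak)^{k/2 − 3/4}) / (√2 (1 − 1/A)^{k/2 − 1/4} k! A^{k + 1/2} (2π)^k) · exp(2π √((1/6)(1 − 1/A)(n − Ak))). -/

import Mathlib

open Finset

/-- number of partitions of `n` -/
def pcount (n : ℕ) : ℕ := Fintype.card (Nat.Partition n)

/-- partitions of `n` with at most `k` parts -/
def pleParts (k n : ℕ) : ℕ :=
  (Finset.univ.filter (fun π : Nat.Partition n => π.parts.card ≤ k)).card

/-- partitions of `n` with at most `k` parts divisible by `A` -/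
def pleA (A k n : ℕ) : ℕ :=
  (Finset.univ.filter
    (fun π : Nat.Partition n => (π.parts.filter (fun r => A ∣ r)).card ≤ k)).card

/-- partitions of `n` with exactly `k` parts divisible by `A` -/
def pexact (A k n : ℕ) : ℕ :=
  (Finset.univ.filter
    (fun π : Nat.Partition n => (π.parts.filter (fun r => A ∣ r)).card = k)).card

/-- `A`-regular partitions of `n` -/
def preg (A n : ℕ) : ℕ :=
  (Finset.univ.filter (fun π : Nat.Partition n => ∀ r ∈ π.parts, ¬ A ∣ r)).card

/-- the Erdős–Lehner sums `S_k(m;j)` -/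
def Sk (k m j : ℕ) : ℕ :=
  ∑ R ∈ ((Finset.Icc 1 j).powersetCard m).filter (fun R => ∑ r ∈ R, (k + r) ≤ j),
    pcount (j - ∑ r ∈ R, (k + r))

open PowerSeries in
lemma PowerSeries.eq_of_eq_add_X_pow_mul {R : Type*} [Semiring R] {m : ℕ} (hm : 0 < m)
    {F G H : R⟦X⟧} (hF : F = H + X ^ m * F) (hG : G = H + X ^ m * G) : F = G := by
  ext n
  induction n using Nat.strong_induction_on with
  | _ n ih =>
    rw [hF, hG, map_add, map_add, coeff_X_pow_mul', coeff_X_pow_mul']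
    split_ifs with h
    · rw [ih (n - m) (by omega)]
    · rfl

/-- The multisets of parts counted by `pexact A k n`. -/
def exactParts (A k n : ℕ) : Set (Multiset ℕ) :=
  {s | (∀ i ∈ s, 0 < i) ∧ s.sum = n ∧ (s.filter (fun r => A ∣ r)).card = k}

lemma exactParts_eq_image (A k n : ℕ) : exactParts A k n = Nat.Partition.parts ''
    ((Finset.univ.filter fun π : Nat.Partition n =>
      (π.parts.filter (fun r => A ∣ r)).card = k : Finset _) : Set (Nat.Partition n)) := by
  ext s
  constructor
  · rintro ⟨h1, h2, h3⟩
    exact ⟨⟨s, fun {i} hi => h1 i hi, h2⟩, by simpa using h3, rfl⟩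
  · rintro ⟨π, hπ, rfl⟩
    exact ⟨fun i hi => π.parts_pos hi, π.parts_sum, by simpa using hπ⟩

lemma finite_exactParts (A k n : ℕ) : (exactParts A k n).Finite := by
  rw [exactParts_eq_image]
  exact (Finset.finite_toSet _).image _

lemma pexact_eq_ncard (A k n : ℕ) : pexact A k n = (exactParts A k n).ncard := by
  rw [exactParts_eq_image, Set.ncard_image_of_injective, Set.ncard_coe_finset]
  · rfl
  · exact fun π π' h => Nat.Partition.ext h

/-- Add `A` to the multiples of `A`. -/
def shiftUp (A i : ℕ) : ℕ := if A ∣ i then i + A else i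

lemma dvd_shiftUp (A i : ℕ) : A ∣ shiftUp A i ↔ A ∣ i := by
  unfold shiftUp
  split_ifs with h <;> simp [h]

lemma shiftUp_injective (A : ℕ) : Function.Injective (shiftUp A) := by
  intro i j h
  have hd : A ∣ i ↔ A ∣ j := by rw [← dvd_shiftUp A i, ← dvd_shiftUp A j, h]
  unfold shiftUp at h
  split_ifs at h <;> omega

lemma card_filter_map_shiftUp (A : ℕ) (s : Multiset ℕ) :
    ((s.map (shiftUp A)).filter (fun r => A ∣ r)).card = (s.filter (fun r => A ∣ r)).card := by
  rw [Multiset.filter_map, Multiset.card_map]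
  congr 1
  exact Multiset.filter_congr fun i _ => by simp [dvd_shiftUp]

lemma sum_map_shiftUp (A : ℕ) (s : Multiset ℕ) :
    (s.map (shiftUp A)).sum = s.sum + A * (s.filter (fun r => A ∣ r)).card := by
  induction s using Multiset.induction_on with
  | empty => simp
  | cons a s ih =>
    by_cases h : A ∣ a
    · simp [shiftUp, h, ih] at *; ring
    · simp [shiftUp, h, ih] at *; ring

lemma exactParts_succ_eq (A k n : ℕ) (hA : 0 < A) :
    exactParts A (k + 1) n =
      (if A ≤ n then (fun s => A ::ₘ s) '' exactParts A k (n - A) else ∅) ∪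
      (if A * (k + 1) ≤ n then Multiset.map (shiftUp A) '' exactParts A (k + 1) (n - A * (k + 1))
        else ∅) := by
  ext s
  constructor
  · rintro ⟨h1, h2, h3⟩
    by_cases hs : A ∈ s
    · left
      obtain ⟨t, rfl⟩ := Multiset.exists_cons_of_mem hs
      simp only [Multiset.sum_cons] at h2
      rw [if_pos (by omega)]
      exact ⟨t, ⟨fun i hi => h1 i (Multiset.mem_cons_of_mem hi), by omega, by simpa using h3⟩, rfl⟩
    · right
      have hs' : (s.map fun i => if A ∣ i then i - A else i).map (shiftUp A) = s := by
        rw [Multiset.map_map]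
        conv_rhs => rw [← Multiset.map_id s]
        refine Multiset.map_congr rfl fun i hi => ?_
        by_cases h : A ∣ i
        · have := Nat.le_of_dvd (h1 i hi) h
          simp only [Function.comp, h, if_true, shiftUp, id, Nat.dvd_sub h (dvd_refl A)]
          omega
        · simp [h, shiftUp]
      set t := s.map fun i => if A ∣ i then i - A else i with ht
      have hc : (t.filter (fun r => A ∣ r)).card = k + 1 := by
        rw [← card_filter_map_shiftUp, hs', h3]
      have hsum := sum_map_shiftUp A t
      rw [hs', hc, h2] at hsum
      rw [if_pos (by omega)]
      refine ⟨t, ⟨fun i hi => ?_, by omega, hc⟩, hs'⟩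
      obtain ⟨j, hj, rfl⟩ := Multiset.mem_map.1 hi
      have hj0 := h1 j hj
      split_ifs with h
      · have := Nat.le_of_dvd hj0 h
        have : j ≠ A := fun h => hs (h ▸ hj)
        omega
      · exact hj0
  · rintro (h | h)
    · split_ifs at h with hn
      · obtain ⟨t, ⟨h1, h2, h3⟩, rfl⟩ := h
        refine ⟨?_, by simp [h2, hn], by simp [h3]⟩
        intro i hi
        rcases Multiset.mem_cons.1 hi with rfl | hi
        exacts [hA, h1 i hi]
      · exact h.elim
    · split_ifs at h with hn
      · obtain ⟨t, ⟨h1, h2, h3⟩, rfl⟩ := h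
        refine ⟨?_, ?_, ?_⟩
        · intro i hi
          obtain ⟨j, hj, rfl⟩ := Multiset.mem_map.1 hi
          have := h1 j hj
          unfold shiftUp
          split_ifs <;> omega
        · rw [sum_map_shiftUp, h2, h3]; omega
        · rw [card_filter_map_shiftUp, h3]
      · exact h.elim

lemma pexact_succ (A k n : ℕ) (hA : 0 < A) :
    pexact A (k + 1) n = (if A ≤ n then pexact A k (n - A) else 0) +
      (if A * (k + 1) ≤ n then pexact A (k + 1) (n - A * (k + 1)) else 0) := by
  rw [pexact_eq_ncard, exactParts_succ_eq A k n hA, Set.ncard_union_eq ?_ ?_ ?_]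
  · congr 1
    · split_ifs
      · rw [Set.ncard_image_of_injective _ (fun s t => (Multiset.cons_inj_right A).1),
          pexact_eq_ncard]
      · simp
    · split_ifs
      · rw [Set.ncard_image_of_injective _ (Multiset.map_injective (shiftUp_injective A)),
          pexact_eq_ncard]
      · simp
  · rw [Set.disjoint_left]
    rintro s h1 h2
    split_ifs at h1 h2
    all_goals try exact h1.elim
    all_goals try exact h2.elim
    obtain ⟨t, -, rfl⟩ := h1
    obtain ⟨u, hu, h⟩ := h2
    have : A ∈ u.map (shiftUp A) := by rw [h]; simp
    obtain ⟨j, hj, hj'⟩ := Multiset.mem_map.1 this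
    have h0 := hu.1 j hj
    unfold shiftUp at hj'
    split_ifs at hj' with hd
    · omega
    · exact hd (hj' ▸ dvd_refl _)
  · split_ifs
    · exact (finite_exactParts _ _ _).image _
    · exact Set.finite_empty
  · split_ifs
    · exact (finite_exactParts _ _ _).image _
    · exact Set.finite_empty

open PowerSeries in
/-- The geometric series `1 + X ^ m + X ^ (2 * m) + ⋯`. -/
def geomPS (m : ℕ) : ℕ⟦X⟧ := PowerSeries.mk fun n => if m ∣ n then 1 else 0

open PowerSeries in
lemma geomPS_eq (m : ℕ) (hm : 0 < m) : geomPS m = 1 + X ^ m * geomPS m := by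
  ext n
  rw [map_add, coeff_X_pow_mul', geomPS, coeff_mk, coeff_one]
  rcases Nat.eq_zero_or_pos n with rfl | hn
  · simp [hm.ne']
  · by_cases h : m ≤ n
    · simp [h, hn.ne', Nat.dvd_sub_iff_left h (dvd_refl m), coeff_mk]
    · have : ¬ m ∣ n := fun hd => h (Nat.le_of_dvd hn hd)
      simp [h, hn.ne', this]

open PowerSeries in
/-- The generating function of `n ↦ pexact A k (n + A * k)`. -/
noncomputable def exactPS (A : ℕ) : ℕ → ℕ⟦X⟧
  | 0 => PowerSeries.mk (pexact A 0)
  | k + 1 => exactPS A k * geomPS (A * (k + 1))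

open PowerSeries in
lemma mk_pexact (A k : ℕ) (hA : 0 < A) :
    PowerSeries.mk (pexact A k) = X ^ (A * k) * exactPS A k := by
  induction k with
  | zero => simp [exactPS]
  | succ k ih =>
    have hm : 0 < A * (k + 1) := by positivity
    refine PowerSeries.eq_of_eq_add_X_pow_mul hm
      (H := X ^ A * PowerSeries.mk (pexact A k)) ?_ ?_
    · ext n
      rw [map_add, coeff_X_pow_mul', coeff_X_pow_mul', coeff_mk, coeff_mk, coeff_mk,
        pexact_succ A k n hA]
    · conv_lhs => rw [exactPS, geomPS_eq _ hm]
      rw [ih, exactPS]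
      ring

open PowerSeries in
lemma pexact_eq_coeff (A k n : ℕ) (hA : 0 < A) (hn : A * k ≤ n) :
    pexact A k n = coeff (n - A * k) (exactPS A k) := by
  have := congrArg (coeff n) (mk_pexact A k hA)
  rwa [coeff_mk, coeff_X_pow_mul', if_pos hn] at this

open PowerSeries PowerSeries.WithPiTopology in
lemma hasProd_exactPS_zero (A : ℕ) :
    HasProd (fun i => if ¬ A ∣ i + 1 then geomPS (i + 1) else 1) (exactPS A 0) := by
  have h := Nat.Partition.hasProd_powerSeriesMk_card_restricted ℕ (fun r => ¬ A ∣ r)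
  have h1 : (PowerSeries.mk fun n => ((#(Nat.Partition.restricted n fun r => ¬ A ∣ r) : ℕ) : ℕ))
      = exactPS A 0 := by
    ext n
    rw [exactPS, coeff_mk, coeff_mk, pexact, Nat.Partition.restricted]
    simp [Multiset.filter_eq_nil]
  rw [← h1]
  convert! h using 2 with i
  split_ifs with hi
  · rfl
  · refine PowerSeries.eq_of_eq_add_X_pow_mul i.succ_pos (geomPS_eq _ i.succ_pos) ?_
    have hs : Summable fun j : ℕ => (X : ℕ⟦X⟧) ^ ((i + 1) * j) := by
      simp_rw [pow_mul]
      exact summable_pow_of_constantCoeff_eq_zero (by simp)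
    have hs' : Summable fun j : ℕ => (X : ℕ⟦X⟧) ^ ((i + 1) * (j + 1)) := by
      simpa [mul_add, pow_add] using hs.mul_right (X ^ (i + 1))
    have key : ∑' j : ℕ, (X : ℕ⟦X⟧) ^ ((i + 1) * j) =
        X ^ ((i + 1) * 0) + ∑' j : ℕ, (X : ℕ⟦X⟧) ^ ((i + 1) * (j + 1)) := by
      rw [tsum_eq_zero_add']
      exact hs'
    have key' : ∑' j : ℕ, (X : ℕ⟦X⟧) ^ ((i + 1) * (j + 1)) =
        X ^ (i + 1) * ∑' j : ℕ, (X : ℕ⟦X⟧) ^ ((i + 1) * j) := by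
      rw [← hs.tsum_mul_left]
      simp only [mul_add, pow_add, mul_one, mul_comm]
    rw [← key', key]
    simp

open PowerSeries in
/-- `f`, evaluated at `q`, converges to `v`. -/
def EvaluatesTo (f : ℕ⟦X⟧) (q v : ℂ) : Prop := HasSum (fun n => ((coeff n f : ℕ) : ℂ) * q ^ n) v

open PowerSeries in
lemma EvaluatesTo.mul {f g : ℕ⟦X⟧} {q v w : ℂ} (hf : EvaluatesTo f q v) (hg : EvaluatesTo g q w) :
    EvaluatesTo (f * g) q (v * w) := by
  have hf' := hf.summable.norm
  have hg' := hg.summable.norm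
  have h := summable_norm_sum_mul_antidiagonal_of_summable_norm hf' hg'
  have h2 := tsum_mul_tsum_eq_tsum_sum_antidiagonal_of_summable_norm hf' hg'
  rw [hf.tsum_eq, hg.tsum_eq] at h2
  rw [h2]
  refine HasSum.congr_fun h.of_norm.hasSum fun n => ?_
  rw [coeff_mul, Nat.cast_sum, Finset.sum_mul]
  refine Finset.sum_congr rfl fun p hp => ?_
  rw [← Finset.HasAntidiagonal.mem_antidiagonal.1 hp, pow_add]
  push_cast
  ring

open PowerSeries in
lemma evaluatesTo_one (q : ℂ) : EvaluatesTo 1 q 1 := by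
  unfold EvaluatesTo
  convert! hasSum_ite_eq 0 (1 : ℂ) using 2 with n
  rw [coeff_one]
  split_ifs with h <;> simp [h]

open PowerSeries in
lemma evaluatesTo_geomPS {m : ℕ} (hm : 0 < m) {q : ℂ} (hq : ‖q‖ < 1) :
    EvaluatesTo (geomPS m) q (1 - q ^ m)⁻¹ := by
  have hqm : ‖q ^ m‖ < 1 := by
    rw [norm_pow]; exact pow_lt_one₀ (norm_nonneg _) hq hm.ne'
  unfold EvaluatesTo
  rw [← Function.Injective.hasSum_iff (mul_right_injective₀ hm.ne')]
  · refine HasSum.congr_fun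
      (hasSum_geometric_of_norm_lt_one hqm) fun j => ?_
    simp [geomPS, pow_mul]
  · intro n hn
    have : ¬ m ∣ n := fun ⟨j, hj⟩ => hn ⟨j, hj.symm⟩
    simp [geomPS, this]

lemma EvaluatesTo.prod {ι : Type*} (s : Finset ι) {f : ι → PowerSeries ℕ} {q : ℂ} {v : ι → ℂ}
    (h : ∀ i ∈ s, EvaluatesTo (f i) q (v i)) : EvaluatesTo (∏ i ∈ s, f i) q (∏ i ∈ s, v i) := by
  classical
  induction s using Finset.induction_on with
  | empty => simpa using evaluatesTo_one q
  | insert a s ha ih =>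
    rw [Finset.prod_insert ha, Finset.prod_insert ha]
    exact (h a (Finset.mem_insert_self _ _)).mul
      (ih fun i hi => h i (Finset.mem_insert_of_mem hi))

open PowerSeries in
lemma PowerSeries.coeff_prod_mono {ι : Type*} {f : ι → ℕ⟦X⟧} (hf : ∀ i, constantCoeff (f i) = 1)
    (n : ℕ) : Monotone fun s : Finset ι => coeff n (∏ i ∈ s, f i) := by
  classical
  intro s t hst
  dsimp only
  rw [← Finset.prod_sdiff hst, coeff_mul]
  have := Finset.single_le_sum (f := fun p : ℕ × ℕ =>
    coeff p.1 (∏ i ∈ t \ s, f i) * coeff p.2 (∏ i ∈ s, f i))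
    (fun _ _ => Nat.zero_le _)
    (Finset.HasAntidiagonal.mem_antidiagonal.2 (zero_add n) : ((0, n) : ℕ × ℕ) ∈ _)
  simpa [map_prod, hf] using this

open PowerSeries PowerSeries.WithPiTopology Filter in
/-- An infinite product of power series with coefficients in `ℕ` may be evaluated factorwise. -/
lemma evaluatesTo_of_hasProd {ι : Type*} {f : ι → ℕ⟦X⟧} {F : ℕ⟦X⟧} (hF : HasProd f F)
    (hf : ∀ i, constantCoeff (f i) = 1) {q : ℂ} {v w : ι → ℂ} {V W : ℂ}
    (hv : ∀ i, EvaluatesTo (f i) q (v i)) (hw : ∀ i, EvaluatesTo (f i) (‖q‖ : ℂ) (w i))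
    (hV : HasProd v V) (hW : HasProd w W) : EvaluatesTo F q V := by
  have hF' : Tendsto (fun s : Finset ι => ∏ i ∈ s, f i) atTop (nhds F) := hF
  have hV' : Tendsto (fun s : Finset ι => ∏ i ∈ s, v i) atTop (nhds V) := hV
  have hW' : Tendsto (fun s : Finset ι => ∏ i ∈ s, w i) atTop (nhds W) := hW
  have hc : ∀ n, ∀ᶠ s : Finset ι in atTop, coeff n (∏ i ∈ s, f i) = coeff n F := by
    intro n
    have := ((continuous_coeff ℕ n).tendsto F).comp hF'
    rwa [nhds_discrete, tendsto_pure] at this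
  have hle : ∀ n (s : Finset ι), coeff n (∏ i ∈ s, f i) ≤ coeff n F := by
    intro n s
    obtain ⟨t, ht, hst⟩ := ((hc n).and (eventually_ge_atTop s)).exists
    rw [← ht]
    exact coeff_prod_mono hf n hst
  have hs : Summable fun n => ((coeff n F : ℕ) : ℝ) * ‖q‖ ^ n := by
    refine summable_of_sum_range_le (c := ‖W‖ + 1) (fun n => by positivity) fun N => ?_
    have h1 : ∀ᶠ s : Finset ι in atTop, ∀ n ∈ Finset.range N,
        coeff n (∏ i ∈ s, f i) = coeff n F :=
      (eventually_all_finset _).2 fun n _ => hc n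
    have h2 : ∀ᶠ s : Finset ι in atTop, ‖∏ i ∈ s, w i‖ < ‖W‖ + 1 :=
      hW'.norm.eventually_lt_const (lt_add_one _)
    obtain ⟨s, hs1, hs2⟩ := (h1.and h2).exists
    have he : EvaluatesTo (∏ i ∈ s, f i) (‖q‖ : ℂ) (∏ i ∈ s, w i) :=
      EvaluatesTo.prod s fun i _ => hw i
    have he' : HasSum (fun n => ((coeff n (∏ i ∈ s, f i) : ℕ) : ℝ) * ‖q‖ ^ n)
        (∏ i ∈ s, w i).re := by
      refine HasSum.congr_fun (Complex.hasSum_re he) fun n => ?_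
      norm_cast
    calc ∑ n ∈ Finset.range N, ((coeff n F : ℕ) : ℝ) * ‖q‖ ^ n
        = ∑ n ∈ Finset.range N, ((coeff n (∏ i ∈ s, f i) : ℕ) : ℝ) * ‖q‖ ^ n :=
          Finset.sum_congr rfl fun n hn => by rw [hs1 n hn]
      _ ≤ (∏ i ∈ s, w i).re := sum_le_hasSum _ (fun n _ => by positivity) he'
      _ ≤ ‖∏ i ∈ s, w i‖ := Complex.re_le_norm _
      _ ≤ _ := hs2.le
  have hsF : Summable fun n => ((coeff n F : ℕ) : ℂ) * q ^ n :=
    Summable.of_norm (by simpa using hs)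
  have hlim : Tendsto (fun s : Finset ι => ∑' n, ((coeff n (∏ i ∈ s, f i) : ℕ) : ℂ) * q ^ n) atTop
      (nhds (∑' n, ((coeff n F : ℕ) : ℂ) * q ^ n)) := by
    refine tendsto_tsum_of_dominated_convergence hs (fun n => ?_) (Eventually.of_forall ?_)
    · refine tendsto_const_nhds.congr' ?_
      filter_upwards [hc n] with s h
      rw [h]
    · intro s n
      rw [norm_mul, norm_pow, Complex.norm_natCast]
      gcongr
      exact hle n s
  have heq : (fun s : Finset ι => ∑' n, ((coeff n (∏ i ∈ s, f i) : ℕ) : ℂ) * q ^ n) =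
      fun s => ∏ i ∈ s, v i := by
    funext s
    exact (EvaluatesTo.prod s fun i _ => hv i).tsum_eq
  rw [heq] at hlim
  rw [tendsto_nhds_unique hV' hlim]
  exact hsF.hasSum

/-- The Euler product `∏ (1 - q ^ n)`. -/
noncomputable def eulerProd (q : ℂ) : ℂ := ∏' n : ℕ, (1 - q ^ (n + 1))

lemma one_sub_pow_ne_zero {q : ℂ} (hq : ‖q‖ < 1) {m : ℕ} (hm : m ≠ 0) : 1 - q ^ m ≠ 0 := by
  intro h
  have : ‖q ^ m‖ < 1 := by rw [norm_pow]; exact pow_lt_one₀ (norm_nonneg _) hq hm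
  rw [← sub_eq_zero.1 h] at this
  simp at this

lemma eulerProd_ne_zero {q : ℂ} (hq : ‖q‖ < 1) : eulerProd q ≠ 0 := by
  refine tprod_one_add_ne_zero_of_summable (f := fun n : ℕ => -q ^ (n + 1)) (fun n => ?_) ?_
  · simpa [← sub_eq_add_neg] using one_sub_pow_ne_zero hq n.succ_ne_zero
  · simpa using (summable_nat_add_iff 1).mpr (summable_geometric_of_lt_one (norm_nonneg _) hq)

/-- The factors of the generating function of `A`-regular partitions. -/
noncomputable def regFactor (A : ℕ) (q : ℂ) (i : ℕ) : ℂ :=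
  if ¬ A ∣ i + 1 then (1 - q ^ (i + 1))⁻¹ else 1

lemma hasProd_regFactor {A : ℕ} (hA : 0 < A) {q : ℂ} (hq : ‖q‖ < 1) :
    HasProd (regFactor A q) (eulerProd (q ^ A) / eulerProd q) := by
  have hqA : ‖q ^ A‖ < 1 := by rw [norm_pow]; exact pow_lt_one₀ (norm_nonneg _) hq hA.ne'
  have h1 : HasProd (fun i : ℕ => if A ∣ i + 1 then 1 - q ^ (i + 1) else 1)
      (eulerProd (q ^ A)) := by
    have hinj : Function.Injective fun j : ℕ => A * (j + 1) - 1 := by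
      intro i j h
      have h' : A * (i + 1) - 1 = A * (j + 1) - 1 := h
      have hi : 0 < A * (i + 1) := by positivity
      have hj : 0 < A * (j + 1) := by positivity
      have h2 : A * (i + 1) = A * (j + 1) := by omega
      simpa using Nat.eq_of_mul_eq_mul_left hA h2
    rw [← Function.Injective.hasProd_iff hinj]
    · refine HasProd.congr_fun
        (ModularForm.multipliable_one_sub_pow hqA).hasProd fun j => ?_
      have hj : 0 < A * (j + 1) := by positivity
      simp [Nat.sub_add_cancel hj, pow_mul]
    · intro i hi
      rw [if_neg]
      rintro ⟨j, hj⟩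
      rcases j with _ | j
      · simp at hj
      · exact hi ⟨j, by simp [← hj]⟩
  have h2 := (ModularForm.multipliable_one_sub_pow hq).hasProd.inv₀ (eulerProd_ne_zero hq)
  rw [div_eq_mul_inv]
  refine HasProd.congr_fun (h1.mul h2) fun i => ?_
  have := one_sub_pow_ne_zero hq i.succ_ne_zero
  unfold regFactor
  by_cases h : A ∣ i + 1
  · simp only [h, if_true, not_true_eq_false, if_false]
    exact (mul_inv_cancel₀ this).symm
  · simp [h]

lemma evaluatesTo_exactPS_zero {A : ℕ} (hA : 0 < A) {q : ℂ} (hq : ‖q‖ < 1) :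
    EvaluatesTo (exactPS A 0) q (eulerProd (q ^ A) / eulerProd q) := by
  have hev : ∀ {x : ℂ}, ‖x‖ < 1 → ∀ i, EvaluatesTo (if ¬ A ∣ i + 1 then geomPS (i + 1) else 1) x
      (regFactor A x i) := by
    intro x hx i
    unfold regFactor
    split_ifs
    · exact evaluatesTo_one x
    · exact evaluatesTo_geomPS i.succ_pos hx
  have hq' : ‖(‖q‖ : ℂ)‖ < 1 := by simpa using hq
  refine evaluatesTo_of_hasProd (hasProd_exactPS_zero A) (fun i => ?_) (hev hq) (hev hq')
    (hasProd_regFactor hA hq) (hasProd_regFactor hA hq')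
  split_ifs
  · simp
  · rw [← PowerSeries.coeff_zero_eq_constantCoeff_apply]
    simp [geomPS]

/-- The function `q ↦ ∑ pexact A k (n + A * k) * q ^ n` in closed form. -/
noncomputable def exactFn (A k : ℕ) (q : ℂ) : ℂ :=
  eulerProd (q ^ A) / eulerProd q * ∏ j ∈ Finset.range k, (1 - q ^ (A * (j + 1)))⁻¹

lemma evaluatesTo_exactPS {A : ℕ} (hA : 0 < A) (k : ℕ) {q : ℂ} (hq : ‖q‖ < 1) :
    EvaluatesTo (exactPS A k) q (exactFn A k q) := by
  induction k with
  | zero => simpa [exactFn] using evaluatesTo_exactPS_zero hA hq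
  | succ k ih =>
    rw [exactPS, exactFn, Finset.prod_range_succ, ← mul_assoc]
    exact ih.mul (evaluatesTo_geomPS (by positivity) hq)

/-- The Dedekind eta function in the variable `z ↦ I * z / (2 * π)`. -/
noncomputable def etaExp (z : ℂ) : ℂ := Complex.exp (-z / 24) * eulerProd (Complex.exp (-z))

lemma eta_eq_etaExp (z : ℂ) : ModularForm.eta (Complex.I * z / (2 * Real.pi)) = etaExp z := by
  have hpi : (Real.pi : ℂ) ≠ 0 := by exact_mod_cast Real.pi_ne_zero
  have h : 2 * Real.pi * Complex.I * (Complex.I * z / (2 * Real.pi)) = -z := by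
    field_simp
    rw [Complex.I_sq]
    ring
  simp only [ModularForm.eta, ModularForm.eta_q_eq_pow, h, etaExp, eulerProd,
    Function.Periodic.qParam]
  norm_num

lemma etaExp_inversion {z : ℂ} (hz : 0 < z.re) :
    etaExp (4 * Real.pi ^ 2 / z) =
      (Complex.sqrt Complex.I)⁻¹ * (Complex.sqrt (Complex.I * z / (2 * Real.pi)) * etaExp z) := by
  have hpi : (Real.pi : ℂ) ≠ 0 := by exact_mod_cast Real.pi_ne_zero
  have hz0 : z ≠ 0 := by rintro rfl; simp at hz
  have hmem : Complex.I * z / (2 * Real.pi) ∈ UpperHalfPlane.upperHalfPlaneSet := by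
    have : Complex.I * z / (2 * Real.pi) = Complex.I * z / ((2 * Real.pi : ℝ) : ℂ) := by
      push_cast; rfl
    rw [UpperHalfPlane.upperHalfPlaneSet, Set.mem_ofPred_eq, this, Complex.div_ofReal_im]
    simp
    positivity
  have h := ModularForm.eta_comp_eq_csqrt_I_inv hmem
  have h2 : -1 / (Complex.I * z / (2 * Real.pi)) =
      Complex.I * (4 * Real.pi ^ 2 / z) / (2 * Real.pi) := by
    field_simp
    rw [Complex.I_sq]
    ring
  simp only [Function.comp_apply, h2, eta_eq_etaExp] at h
  simpa [eta_eq_etaExp] using h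

lemma norm_exp_neg_lt_one {z : ℂ} (hz : 0 < z.re) : ‖Complex.exp (-z)‖ < 1 := by
  rw [Complex.norm_exp]
  simpa using hz

lemma eulerProd_ratio_eq {A : ℕ} (hA : 0 < A) {z : ℂ} (hz : 0 < z.re) :
    eulerProd (Complex.exp (-z) ^ A) / eulerProd (Complex.exp (-z)) =
      (Real.sqrt A : ℂ)⁻¹ * Complex.exp ((A - 1) * z / 24) *
        Complex.exp ((Real.pi ^ 2 / 6 * (1 - 1 / A) : ℝ) / z) *
        (eulerProd (Complex.exp (-(4 * Real.pi ^ 2 / (A * z)))) /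
          eulerProd (Complex.exp (-(4 * Real.pi ^ 2 / z)))) := by
  have hA' : (0 : ℝ) < A := by exact_mod_cast hA
  have hAC : (A : ℂ) ≠ 0 := by exact_mod_cast hA.ne'
  have hz0 : z ≠ 0 := by rintro rfl; simp at hz
  have hAz : 0 < ((A : ℂ) * z).re := by simp; positivity
  have h1 := etaExp_inversion hz
  have h2 := etaExp_inversion hAz
  have hinv : 0 < (4 * Real.pi ^ 2 / z).re := by
    have : 4 * (Real.pi : ℂ) ^ 2 / z = ((4 * Real.pi ^ 2 : ℝ) : ℂ) * z⁻¹ := by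
      push_cast; rw [div_eq_mul_inv]
    rw [this, Complex.re_ofReal_mul, Complex.inv_re]
    have := Complex.normSq_pos.2 hz0
    positivity
  have hsq : Complex.sqrt (Complex.I * (A * z) / (2 * Real.pi)) =
      Real.sqrt A * Complex.sqrt (Complex.I * z / (2 * Real.pi)) := by
    have hw : Complex.I * z / (2 * Real.pi) ≠ 0 := by simp [hz0]
    have hs : (Real.sqrt A : ℂ) = Complex.sqrt ((A : ℝ) : ℂ) := by
      rw [Complex.sqrt_of_nonneg (by exact_mod_cast hA'.le), Complex.ofReal_re]
    have hm : Complex.I * (A * z) / (2 * Real.pi) =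
        ((A : ℝ) : ℂ) * (Complex.I * z / (2 * Real.pi)) := by push_cast; ring
    rw [hs, hm, sqrt_eq_exp (mul_ne_zero (by simpa using hAC) hw), sqrt_eq_exp hw,
      sqrt_eq_exp (by simpa using hAC), Complex.log_ofReal_mul hA' hw, ← Complex.exp_add,
      Complex.ofReal_log hA'.le]
    ring_nf
  have hsqrtA : (Real.sqrt A : ℂ) ≠ 0 := by
    exact_mod_cast (Real.sqrt_pos.2 hA').ne'
  have hp1 := eulerProd_ne_zero (norm_exp_neg_lt_one hz)
  have hp2 := eulerProd_ne_zero (norm_exp_neg_lt_one hinv)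
  have he2 : etaExp (4 * Real.pi ^ 2 / z) ≠ 0 := mul_ne_zero (Complex.exp_ne_zero _) hp2
  have he1 : etaExp z ≠ 0 := mul_ne_zero (Complex.exp_ne_zero _) hp1
  have key : etaExp (A * z) / etaExp z = (Real.sqrt A : ℂ)⁻¹ *
      (etaExp (4 * Real.pi ^ 2 / (A * z)) / etaExp (4 * Real.pi ^ 2 / z)) := by
    rw [h2, hsq]
    rw [h1] at he2 ⊢
    have ha := (mul_ne_zero_iff.1 he2).1
    have hb := (mul_ne_zero_iff.1 (mul_ne_zero_iff.1 he2).2).1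
    have hc := inv_ne_zero ha
    rw [inv_inv] at hc
    generalize Complex.sqrt (Complex.I * z / (2 * Real.pi)) = w at hb ⊢
    field_simp
  have hexp : Complex.exp (-z) ^ A = Complex.exp (-(A * z)) := by
    rw [← Complex.exp_nat_mul]; ring_nf
  unfold etaExp at key
  rw [hexp]
  rw [mul_div_mul_comm, mul_div_mul_comm, ← Complex.exp_sub, ← Complex.exp_sub] at key
  have hd : eulerProd (Complex.exp (-(A * z))) / eulerProd (Complex.exp (-z)) =
      Complex.exp ((A - 1) * z / 24) * (Complex.exp (-(A * z) / 24 - -z / 24) *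
        (eulerProd (Complex.exp (-(A * z))) / eulerProd (Complex.exp (-z)))) := by
    rw [← mul_assoc, ← Complex.exp_add]
    ring_nf
    simp
  rw [hd, key]
  have : -(4 * (Real.pi : ℂ) ^ 2 / (A * z)) / 24 - -(4 * (Real.pi : ℂ) ^ 2 / z) / 24 =
      (Real.pi ^ 2 / 6 * (1 - 1 / A) : ℝ) / z := by
    push_cast
    field_simp
    ring
  rw [this]
  ring

open Filter Topology in
lemma tendsto_eulerProd_zero : Tendsto eulerProd (𝓝 0) (𝓝 1) := by
  have h := (ModularForm.differentiableOn_tprod_one_sub_pow.continuousOn).continuousAt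
    (x := 0) (Metric.ball_mem_nhds 0 one_pos)
  have h0 : eulerProd 0 = 1 := by simp [eulerProd]
  have := h.tendsto
  change Tendsto eulerProd (𝓝 0) (𝓝 (eulerProd 0)) at this
  rwa [h0] at this

open Filter Topology in
lemma tendsto_exactFn {α : Type*} {l : Filter α} {A : ℕ} (hA : 0 < A) (k : ℕ) {z : α → ℂ}
    (hpos : ∀ᶠ x in l, 0 < (z x).re) (hz : Tendsto z l (𝓝 0))
    (hinv : Tendsto (fun x => ((z x)⁻¹).re) l atTop) :
    Tendsto (fun x => exactFn A k (Complex.exp (-z x)) * z x ^ k *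
        Complex.exp (-((Real.pi ^ 2 / 6 * (1 - 1 / A) : ℝ) / z x))) l
      (𝓝 ((Real.sqrt A : ℂ)⁻¹ * ∏ j ∈ Finset.range k, ((A * (j + 1) : ℕ) : ℂ)⁻¹)) := by
  have hexp0 : ∀ {a : ℝ}, 0 < a →
      Tendsto (fun x => eulerProd (Complex.exp (-(a / z x)))) l (𝓝 1) := by
    intro a ha
    refine tendsto_eulerProd_zero.comp (tendsto_zero_iff_norm_tendsto_zero.2 ?_)
    have : ∀ x, ‖Complex.exp (-(a / z x))‖ = Real.exp (-(a * ((z x)⁻¹).re)) := by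
      intro x
      rw [Complex.norm_exp, Complex.neg_re, div_eq_mul_inv, Complex.re_ofReal_mul]
    simp_rw [this]
    exact Real.tendsto_exp_neg_atTop_nhds_zero.comp (hinv.const_mul_atTop ha)
  have h1 : Tendsto (fun x => eulerProd (Complex.exp (-(4 * Real.pi ^ 2 / (A * z x)))) /
          eulerProd (Complex.exp (-(4 * Real.pi ^ 2 / z x)))) l (𝓝 1) := by
    have ha := hexp0 (a := 4 * Real.pi ^ 2 / A) (by positivity)
    have hb := hexp0 (a := 4 * Real.pi ^ 2) (by positivity)
    have := ha.div hb one_ne_zero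
    rw [div_one] at this
    refine this.congr fun x => ?_
    push_cast
    simp only [Pi.div_apply, div_div]
  have h2 : Tendsto (fun x => Complex.exp ((A - 1) * z x / 24)) l (𝓝 1) := by
    have h := (Complex.continuous_exp.comp
      (show Continuous fun w : ℂ => ((A : ℂ) - 1) * w / 24 by fun_prop)).tendsto 0
    simpa [Function.comp_def] using h.comp hz
  have hz' : Tendsto z l (𝓝[≠] 0) := by
    refine tendsto_nhdsWithin_iff.2 ⟨hz, ?_⟩
    filter_upwards [hpos] with x hx h
    simp only [Set.mem_singleton_iff] at h
    simp [h] at hx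
  have h3 : ∀ m : ℕ, 0 < m → Tendsto (fun x => z x * (1 - Complex.exp (-z x) ^ m)⁻¹) l
      (𝓝 (m : ℂ)⁻¹) := by
    intro m hm
    have hd : HasDerivAt (fun w : ℂ => 1 - Complex.exp (-w) ^ m) (m : ℂ) 0 := by
      have := (((hasDerivAt_neg (0 : ℂ)).cexp).pow m).const_sub 1
      convert! this using 1
      simp
    have := (hd.tendsto_slope_zero.comp hz').inv₀ (by exact_mod_cast hm.ne')
    refine this.congr fun x => ?_
    simp [mul_comm]
  have h4 : Tendsto (fun x => ∏ j ∈ Finset.range k,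
      (z x * (1 - Complex.exp (-z x) ^ (A * (j + 1)))⁻¹)) l
      (𝓝 (∏ j ∈ Finset.range k, ((A * (j + 1) : ℕ) : ℂ)⁻¹)) :=
    tendsto_finsetProd _ fun j _ => h3 _ (by positivity)
  have h := ((h1.mul h2).const_mul (Real.sqrt A : ℂ)⁻¹).mul h4
  rw [mul_one, mul_one] at h
  refine h.congr' ?_
  filter_upwards [hpos] with x hx
  rw [exactFn, eulerProd_ratio_eq hA hx, Finset.prod_mul_distrib, Finset.prod_const,
    Finset.card_range]
  have hE := Complex.exp_neg ((Real.pi ^ 2 / 6 * (1 - 1 / A) : ℝ) / z x)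
  have hE0 := Complex.exp_ne_zero ((Real.pi ^ 2 / 6 * (1 - 1 / A) : ℝ) / z x)
  rw [hE]
  generalize Complex.exp ((Real.pi ^ 2 / 6 * (1 - 1 / A) : ℝ) / z x) = E at hE0 ⊢
  rw [mul_assoc _ E, mul_comm E, ← mul_assoc _ _ E, mul_assoc _ E, mul_comm E]
  rw [eq_mul_inv_iff_mul_eq₀ hE0]
  ring

lemma norm_one_sub_mul_sq {u : ℂ} (hu : ‖u‖ = 1) (x : ℝ) :
    ‖1 - x * u‖ ^ 2 = (1 - x) ^ 2 + x * ‖1 - u‖ ^ 2 := by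
  have h : u.re ^ 2 + u.im ^ 2 = 1 := by
    have := Complex.sq_norm u
    rw [hu, Complex.normSq_apply] at this
    linarith
  rw [Complex.sq_norm, Complex.sq_norm, Complex.normSq_apply, Complex.normSq_apply]
  simp
  linear_combination (x ^ 2 - x) * h

lemma norm_inv_one_sub_le {u : ℂ} (hu : ‖u‖ = 1) {x : ℝ} (hx0 : 0 ≤ x) (hx1 : x < 1) :
    ‖(1 - x * u)⁻¹‖ ≤ ‖(1 - (x : ℂ))⁻¹‖ * Real.exp (-(x * ‖1 - u‖ ^ 2 / 10)) := by
  set y := x * ‖1 - u‖ ^ 2 with hy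
  have hD : ‖1 - u‖ ≤ 2 := by
    refine (norm_sub_le _ _).trans ?_
    rw [hu, norm_one]; norm_num
  have hy0 : 0 ≤ y := by positivity
  have hy4 : y ≤ 4 := by nlinarith [norm_nonneg (1 - u), sq_nonneg ‖1 - u‖]
  have hsq := norm_one_sub_mul_sq hu x
  rw [← hy] at hsq
  have hexp : Real.exp (y / 5) ≤ 1 + y := by
    have h1 : 1 - y / 5 ≤ Real.exp (-(y / 5)) := by linarith [Real.add_one_le_exp (-(y / 5))]
    have h2 : Real.exp (y / 5) * Real.exp (-(y / 5)) = 1 := by rw [← Real.exp_add]; simp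
    nlinarith [Real.exp_pos (y / 5), Real.exp_pos (-(y / 5))]
  have hn : ‖1 - (x : ℂ)‖ = 1 - x := by
    rw [← Complex.ofReal_one, ← Complex.ofReal_sub, Complex.norm_real, Real.norm_of_nonneg]
    linarith
  have hpos : 0 < ‖1 - x * u‖ := by
    refine lt_of_pow_lt_pow_left₀ 2 (norm_nonneg _) ?_
    rw [hsq]
    nlinarith
  rw [norm_inv, norm_inv, hn, Real.exp_neg, ← mul_inv]
  refine inv_anti₀ (by have := Real.exp_pos (y / 10); nlinarith) ?_
  refine le_of_sq_le_sq ?_ hpos.le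
  rw [hsq, mul_pow, ← Real.exp_nat_mul]
  have : ((2 : ℕ) : ℝ) * (y / 10) = y / 5 := by push_cast; ring
  rw [this]
  calc (1 - x) ^ 2 * Real.exp (y / 5) ≤ (1 - x) ^ 2 * (1 + y) := by gcongr
    _ ≤ _ := by nlinarith [mul_nonneg hy0 hx0]

/-- The squared distances from `1` of the powers of `u` with exponent not divisible by `A`. -/
noncomputable def regDistSq (A : ℕ) (u : ℂ) (m : ℕ) : ℝ := if A ∣ m then 0 else ‖1 - u ^ m‖ ^ 2

lemma norm_one_sub_pow_sq_le {u : ℂ} (hu : ‖u‖ = 1) (m : ℕ) : ‖1 - u ^ m‖ ^ 2 ≤ 4 := by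
  have : ‖1 - u ^ m‖ ≤ 2 := by
    refine (norm_sub_le _ _).trans ?_
    rw [norm_pow, hu, norm_one]; norm_num
  nlinarith [norm_nonneg (1 - u ^ m)]

lemma regDistSq_nonneg (A : ℕ) (u : ℂ) (m : ℕ) : 0 ≤ regDistSq A u m := by
  unfold regDistSq; positivity

lemma regDistSq_le (A : ℕ) {u : ℂ} (hu : ‖u‖ = 1) (m : ℕ) : regDistSq A u m ≤ 4 := by
  unfold regDistSq
  split_ifs
  · norm_num
  · exact norm_one_sub_pow_sq_le hu m

lemma summable_pow_mul_of_le {f : ℕ → ℝ} (h0 : ∀ m, 0 ≤ f m) {C : ℝ} (hC : ∀ m, f m ≤ C) {r : ℝ}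
    (hr0 : 0 ≤ r) (hr1 : r < 1) : Summable fun m => r ^ m * f m :=
  Summable.of_nonneg_of_le (fun m => by have := h0 m; positivity)
    (fun m => mul_le_mul_of_nonneg_left (hC m) (by positivity))
    ((summable_geometric_of_lt_one hr0 hr1).mul_right C)

open Filter Topology in
lemma norm_eulerProd_ratio_le {A : ℕ} (hA : 0 < A) {u : ℂ} (hu : ‖u‖ = 1) {r : ℝ} (hr0 : 0 ≤ r)
    (hr1 : r < 1) :
    ‖eulerProd ((r * u) ^ A) / eulerProd (r * u)‖ ≤ ‖eulerProd ((r : ℂ) ^ A) / eulerProd r‖ *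
      Real.exp (-((∑' m, r ^ m * regDistSq A u m) / 10)) := by
  have hs := summable_pow_mul_of_le (regDistSq_nonneg A u) (regDistSq_le A hu) hr0 hr1
  have hs' : HasSum (fun i => r ^ (i + 1) * regDistSq A u (i + 1))
      (∑' m, r ^ m * regDistSq A u m) := by
    have := (hasSum_nat_add_iff' 1).2 hs.hasSum
    simpa [regDistSq] using this
  have h1 : Tendsto (fun s : Finset ℕ => ∏ i ∈ s, ‖regFactor A (r * u) i‖) atTop
      (𝓝 ‖eulerProd ((r * u) ^ A) / eulerProd (r * u)‖) :=
    (hasProd_regFactor hA (by simpa [hu, abs_of_nonneg hr0] using hr1)).norm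
  have h2 : Tendsto (fun s : Finset ℕ => ∏ i ∈ s, ‖regFactor A r i‖) atTop
      (𝓝 ‖eulerProd ((r : ℂ) ^ A) / eulerProd r‖) :=
    (hasProd_regFactor hA (by simpa [abs_of_nonneg hr0] using hr1)).norm
  have h3 : Tendsto (fun s : Finset ℕ => Real.exp (-((∑ i ∈ s, r ^ (i + 1) *
      regDistSq A u (i + 1)) / 10))) atTop
      (𝓝 (Real.exp (-((∑' m, r ^ m * regDistSq A u m) / 10)))) :=
    (Real.continuous_exp.tendsto _).comp ((Tendsto.div_const hs' 10).neg)
  refine le_of_tendsto_of_tendsto' h1 (h2.mul h3) fun s => ?_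
  rw [Finset.sum_div, ← Finset.sum_neg_distrib, Real.exp_sum, ← Finset.prod_mul_distrib]
  refine Finset.prod_le_prod (fun _ _ => norm_nonneg _) fun i _ => ?_
  unfold regFactor regDistSq
  by_cases h : A ∣ i + 1
  · simp [h]
  · simp only [h, not_false_eq_true, if_true, if_false]
    have := norm_inv_one_sub_le (u := u ^ (i + 1)) (by simp [hu]) (pow_nonneg hr0 (i + 1))
      (pow_lt_one₀ hr0 hr1 i.succ_ne_zero)
    rw [mul_pow]
    exact_mod_cast this

lemma norm_exactFn_le {A : ℕ} (hA : 0 < A) (k : ℕ) {u : ℂ} (hu : ‖u‖ = 1) {r : ℝ} (hr0 : 0 ≤ r)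
    (hr1 : r < 1) :
    ‖exactFn A k (r * u)‖ ≤ ‖exactFn A k r‖ *
      Real.exp (-((∑' m, r ^ m * regDistSq A u m) / 10)) := by
  unfold exactFn
  rw [norm_mul, norm_mul, norm_prod, norm_prod, mul_right_comm]
  gcongr with j hj
  · exact norm_eulerProd_ratio_le hA hu hr0 hr1
  · have h := norm_inv_one_sub_le (u := u ^ (A * (j + 1))) (by simp [hu])
      (pow_nonneg hr0 (A * (j + 1))) (pow_lt_one₀ hr0 hr1 (by positivity))
    push_cast at h
    rw [mul_pow]
    refine h.trans (mul_le_of_le_one_right (norm_nonneg _) (Real.exp_le_one_iff.2 ?_))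
    simp only [Left.neg_nonpos_iff]
    positivity

lemma nat_mul_pow_le {r : ℝ} (hr0 : 0 ≤ r) (hr1 : r < 1) (m : ℕ) : m * r ^ m ≤ (1 - r)⁻¹ := by
  calc (m : ℝ) * r ^ m = ∑ _i ∈ range m, r ^ m := by simp
    _ ≤ ∑ i ∈ range m, r ^ i := by
        refine Finset.sum_le_sum fun i hi => pow_le_pow_of_le_one hr0 hr1.le ?_
        exact (Finset.mem_range.1 hi).le
    _ ≤ ∑' i, r ^ i := (summable_geometric_of_lt_one hr0 hr1).sum_le_tsum _
        fun i _ => by positivity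
    _ = _ := tsum_geometric_of_lt_one hr0 hr1

lemma norm_one_sub_mul_sq_le {v w : ℂ} (hv : ‖v‖ = 1) :
    ‖1 - v * w‖ ^ 2 ≤ 2 * ‖1 - v‖ ^ 2 + 2 * ‖1 - w‖ ^ 2 := by
  have : ‖1 - v * w‖ ≤ ‖1 - v‖ + ‖1 - w‖ := by
    calc ‖1 - v * w‖ = ‖(1 - v) + v * (1 - w)‖ := by ring_nf
      _ ≤ ‖1 - v‖ + ‖v * (1 - w)‖ := norm_add_le _ _
      _ = _ := by rw [norm_mul, hv, one_mul]
  nlinarith [norm_nonneg (1 - v * w), sq_nonneg (‖1 - v‖ - ‖1 - w‖)]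

lemma summable_nat_mul_pow_mul_of_le {f : ℕ → ℝ} (h0 : ∀ m, 0 ≤ f m) {C : ℝ} (hC : ∀ m, f m ≤ C)
    {r : ℝ} (hr0 : 0 ≤ r) (hr1 : r < 1) : Summable fun m : ℕ => m * r ^ m * f m := by
  have h := summable_pow_mul_geometric_of_norm_lt_one 1 (r := r) (by simpa [abs_of_nonneg hr0])
  simp only [pow_one] at h
  exact Summable.of_nonneg_of_le (fun m => by have := h0 m; positivity)
    (fun m => mul_le_mul_of_nonneg_left (hC m) (by positivity)) (h.mul_right C)

/-- Exponents divisible by `A` are controlled by the exponents congruent to `±1` modulo `A`. -/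
lemma tsum_multiples_le {A : ℕ} (hA : 2 ≤ A) {u : ℂ} (hu : ‖u‖ = 1) {r : ℝ} (hr0 : 0 ≤ r)
    (hr1 : r < 1) :
    ∑' n : ℕ, ((n + 1 : ℕ) : ℝ) * r ^ (A * (n + 1)) * ‖1 - u ^ (A * (n + 1))‖ ^ 2 ≤
      4 * (∑' m, r ^ m * regDistSq A u m) * (1 - r)⁻¹ := by
  set S := ∑' m, r ^ m * regDistSq A u m
  have hs := summable_pow_mul_of_le (regDistSq_nonneg A u) (regDistSq_le A hu) hr0 hr1
  have hg := summable_geometric_of_lt_one hr0 hr1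
  have hS0 : 0 ≤ S := tsum_nonneg fun m => mul_nonneg (by positivity) (regDistSq_nonneg A u m)
  have hinj : ∀ b : ℕ, Function.Injective fun i : ℕ => A * i + b := by
    intro b i j h
    have h' : A * i = A * j := by simpa using h
    exact Nat.eq_of_mul_eq_mul_left (by omega) h'
  have hx := fun b => hs.comp_injective (hinj b)
  have hy := fun b => hg.comp_injective (hinj b)
  have hxS : ∀ b, ∑' i : ℕ, r ^ (A * i + b) * regDistSq A u (A * i + b) ≤ S := fun b =>
    tsum_comp_le_tsum_of_inj hs (fun m => mul_nonneg (by positivity) (regDistSq_nonneg A u m))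
      (hinj b)
  have hyS : ∀ b, ∑' i : ℕ, r ^ (A * i + b) ≤ (1 - r)⁻¹ := fun b => by
    rw [← tsum_geometric_of_lt_one hr0 hr1]
    exact tsum_comp_le_tsum_of_inj hg (fun m => by positivity) (hinj b)
  have hprod : ∀ b b',
      Summable (fun n => ∑ p ∈ antidiagonal n, r ^ (A * p.1 + b) * regDistSq A u (A * p.1 + b) *
        r ^ (A * p.2 + b')) ∧
      ∑' n, ∑ p ∈ antidiagonal n, r ^ (A * p.1 + b) * regDistSq A u (A * p.1 + b) *
        r ^ (A * p.2 + b') ≤ S * (1 - r)⁻¹ := by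
    intro b b'
    refine ⟨(summable_norm_sum_mul_antidiagonal_of_summable_norm (hx b).norm (hy b').norm).of_norm,
      ?_⟩
    have h := tsum_mul_tsum_eq_tsum_sum_antidiagonal_of_summable_norm (hx b).norm (hy b').norm
    simp only [Function.comp_apply] at h
    rw [← h]
    exact mul_le_mul (hxS b) (hyS b') (tsum_nonneg fun _ => by positivity) hS0
  have hP := hprod 1 (A - 1)
  have hQ := hprod (A - 1) 1
  have hbound : ∀ n : ℕ, ((n + 1 : ℕ) : ℝ) * r ^ (A * (n + 1)) * ‖1 - u ^ (A * (n + 1))‖ ^ 2 ≤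
      2 * (∑ p ∈ antidiagonal n, r ^ (A * p.1 + 1) * regDistSq A u (A * p.1 + 1) *
        r ^ (A * p.2 + (A - 1))) +
      2 * (∑ p ∈ antidiagonal n, r ^ (A * p.1 + (A - 1)) * regDistSq A u (A * p.1 + (A - 1)) *
        r ^ (A * p.2 + 1)) := by
    intro n
    have hsw : ∑ p ∈ antidiagonal n, r ^ (A * p.1 + (A - 1)) *
        regDistSq A u (A * p.1 + (A - 1)) * r ^ (A * p.2 + 1) =
        ∑ p ∈ antidiagonal n, r ^ (A * p.2 + (A - 1)) *
        regDistSq A u (A * p.2 + (A - 1)) * r ^ (A * p.1 + 1) := by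
      rw [← Finset.Nat.sum_antidiagonal_swap]; rfl
    have hl : ((n + 1 : ℕ) : ℝ) * r ^ (A * (n + 1)) * ‖1 - u ^ (A * (n + 1))‖ ^ 2 =
        ∑ _p ∈ antidiagonal n, r ^ (A * (n + 1)) * ‖1 - u ^ (A * (n + 1))‖ ^ 2 := by
      rw [Finset.sum_const, Finset.Nat.card_antidiagonal, nsmul_eq_mul, mul_assoc]
    rw [hsw, hl, Finset.mul_sum, Finset.mul_sum, ← Finset.sum_add_distrib]
    refine Finset.sum_le_sum fun p hp => ?_
    have hpn := Finset.HasAntidiagonal.mem_antidiagonal.1 hp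
    have he : A * (n + 1) = (A * p.1 + 1) + (A * p.2 + (A - 1)) := by
      rw [← hpn]
      zify [show 1 ≤ A by omega]
      ring
    have hd1 : ¬ A ∣ A * p.1 + 1 := by
      rw [Nat.dvd_add_right (dvd_mul_right _ _)]
      exact fun h => by have := Nat.le_of_dvd one_pos h; omega
    have hd2 : ¬ A ∣ A * p.2 + (A - 1) := by
      rw [Nat.dvd_add_right (dvd_mul_right _ _)]
      exact fun h => by have := Nat.le_of_dvd (by omega) h; omega
    rw [he, pow_add r, pow_add u]
    simp only [regDistSq, hd1, hd2, if_false]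
    have h := norm_one_sub_mul_sq_le (v := u ^ (A * p.1 + 1)) (w := u ^ (A * p.2 + (A - 1)))
      (by simp [hu])
    have hr : 0 ≤ r ^ (A * p.1 + 1) * r ^ (A * p.2 + (A - 1)) := by positivity
    nlinarith [mul_le_mul_of_nonneg_left h hr]
  have hsum := (hP.1.mul_left 2).add (hQ.1.mul_left 2)
  refine (Summable.tsum_le_tsum hbound ?_ hsum).trans ?_
  · exact Summable.of_nonneg_of_le (fun n => by positivity) hbound hsum
  · rw [(hP.1.mul_left 2).tsum_add (hQ.1.mul_left 2), tsum_mul_left, tsum_mul_left]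
    linarith [hP.2, hQ.2]

lemma tsum_nat_mul_le {A : ℕ} (hA : 2 ≤ A) {u : ℂ} (hu : ‖u‖ = 1) {ρ : ℝ} (h0 : 0 ≤ ρ)
    (h1 : ρ < 1) :
    ∑' m : ℕ, m * (ρ ^ 2) ^ m * ‖1 - u ^ m‖ ^ 2 ≤
      (4 * A + 1) * (∑' m, ρ ^ m * regDistSq A u m) * (1 - ρ)⁻¹ := by
  have hr0 : 0 ≤ ρ ^ 2 := by positivity
  have hrρ : ρ ^ 2 ≤ ρ := by nlinarith
  have hr1 : ρ ^ 2 < 1 := by nlinarith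
  set r := ρ ^ 2 with hr
  have hs := summable_pow_mul_of_le (regDistSq_nonneg A u) (regDistSq_le A hu) h0 h1
  have hsr := summable_pow_mul_of_le (regDistSq_nonneg A u) (regDistSq_le A hu) hr0 hr1
  have hSle : ∑' m, r ^ m * regDistSq A u m ≤ ∑' m, ρ ^ m * regDistSq A u m :=
    hsr.tsum_le_tsum (fun m => mul_le_mul_of_nonneg_right (pow_le_pow_left₀ hr0 hrρ m)
      (regDistSq_nonneg A u m)) hs
  have hM := summable_nat_mul_pow_mul_of_le (regDistSq_nonneg A u) (regDistSq_le A hu) hr0 hr1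
  have hreg : ∑' m : ℕ, m * r ^ m * regDistSq A u m ≤
      (∑' m, ρ ^ m * regDistSq A u m) * (1 - ρ)⁻¹ := by
    rw [← tsum_mul_right]
    refine hM.tsum_le_tsum (fun m => ?_) (hs.mul_right _)
    have := nat_mul_pow_le h0 h1 m
    have h3 := mul_le_mul_of_nonneg_left this
      (mul_nonneg (pow_nonneg h0 m) (regDistSq_nonneg A u m))
    calc m * r ^ m * regDistSq A u m = ρ ^ m * regDistSq A u m * (m * ρ ^ m) := by
          rw [hr, ← pow_mul, mul_comm 2 m, pow_mul]; ring
      _ ≤ _ := h3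
  set g : ℕ → ℝ := fun m => if A ∣ m then ‖1 - u ^ m‖ ^ 2 else 0 with hg
  have hg0 : ∀ m, 0 ≤ g m := fun m => by simp only [hg]; positivity
  have hg4 : ∀ m, g m ≤ 4 := fun m => by
    simp only [hg]
    split_ifs
    · exact norm_one_sub_pow_sq_le hu m
    · norm_num
  have hG := summable_nat_mul_pow_mul_of_le hg0 hg4 hr0 hr1
  have hinj : Function.Injective fun j : ℕ => A * j := mul_right_injective₀ (by omega)
  have hGeq : ∑' m : ℕ, m * r ^ m * g m = A * ∑' n : ℕ, ((n + 1 : ℕ) : ℝ) * r ^ (A * (n + 1)) *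
      ‖1 - u ^ (A * (n + 1))‖ ^ 2 := by
    have hG' : Summable fun c : ℕ => ((A * c : ℕ) : ℝ) * r ^ (A * c) * g (A * c) :=
      hG.comp_injective hinj
    rw [← hinj.tsum_eq, hG'.tsum_eq_zero_add, ← tsum_mul_left]
    · simp only [mul_zero, Nat.cast_zero, zero_mul, zero_add]
      refine tsum_congr fun n => ?_
      simp only [hg, dvd_mul_right, if_true]
      push_cast
      ring
    · intro m hm
      by_contra h
      refine hm ?_
      have : ¬ A ∣ m := fun ⟨j, hj⟩ => h ⟨j, hj.symm⟩
      simp [hg, this]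
  have hsplit : ∑' m : ℕ, m * r ^ m * ‖1 - u ^ m‖ ^ 2 =
      ∑' m : ℕ, m * r ^ m * regDistSq A u m + ∑' m : ℕ, m * r ^ m * g m := by
    rw [← hM.tsum_add hG]
    refine tsum_congr fun m => ?_
    simp only [hg, regDistSq]
    split_ifs <;> ring
  have hmul := tsum_multiples_le hA hu hr0 hr1
  have hinv : (1 - r)⁻¹ ≤ (1 - ρ)⁻¹ := inv_anti₀ (by linarith) (by linarith)
  have hS0 : 0 ≤ ∑' m, r ^ m * regDistSq A u m :=
    tsum_nonneg fun m => mul_nonneg (by positivity) (regDistSq_nonneg A u m)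
  have hpos : 0 ≤ (1 - ρ)⁻¹ := inv_nonneg.2 (by linarith)
  have : (∑' m, r ^ m * regDistSq A u m) * (1 - r)⁻¹ ≤
      (∑' m, ρ ^ m * regDistSq A u m) * (1 - ρ)⁻¹ :=
    mul_le_mul hSle hinv (inv_nonneg.2 (by linarith)) (hS0.trans hSle)
  have hA0 : (0 : ℝ) ≤ A := by positivity
  rw [hsplit, hGeq]
  nlinarith [mul_le_mul_of_nonneg_left hmul hA0, mul_le_mul_of_nonneg_left this hA0]

lemma le_tsum_nat_mul {u : ℂ} (hu : ‖u‖ = 1) {r : ℝ} (hr0 : 0 ≤ r) (hr1 : r < 1) :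
    2 * r ^ 2 * ‖1 - u‖ ^ 2 / ((1 - r) ^ 2 * ((1 - r) ^ 2 + r * ‖1 - u‖ ^ 2)) ≤
      ∑' m : ℕ, m * r ^ m * ‖1 - u ^ m‖ ^ 2 := by
  have hw : ‖(r : ℂ) * u‖ < 1 := by simpa [hu, abs_of_nonneg hr0] using hr1
  have h1 := hasSum_coe_mul_geometric_of_norm_lt_one (r := r) (by simpa [abs_of_nonneg hr0])
  have h2 := Complex.hasSum_re (hasSum_coe_mul_geometric_of_norm_lt_one hw)
  have h3 : HasSum (fun m : ℕ => m * r ^ m * ‖1 - u ^ m‖ ^ 2)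
      (2 * (r / (1 - r) ^ 2) - 2 * (r * u / (1 - r * u) ^ 2).re) := by
    refine HasSum.congr_fun ((h1.mul_left 2).sub (h2.mul_left 2)) fun m => ?_
    have hsq : ‖1 - u ^ m‖ ^ 2 = 2 - 2 * (u ^ m).re := by
      have hm : ‖u ^ m‖ = 1 := by simp [hu]
      have := Complex.sq_norm_sub_sq_re (u ^ m)
      rw [hm] at this
      rw [Complex.sq_norm, Complex.normSq_apply]
      simp only [Complex.sub_re, Complex.sub_im, Complex.one_re, Complex.one_im]
      linear_combination -this
    have hre : ((m : ℂ) * (r * u) ^ m).re = m * r ^ m * (u ^ m).re := by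
      have : (m : ℂ) * (r * u) ^ m = ((m * r ^ m : ℝ) : ℂ) * u ^ m := by push_cast; ring
      rw [this, Complex.re_ofReal_mul]
    rw [hsq, hre]
    ring
  rw [h3.tsum_eq]
  have hsq := norm_one_sub_mul_sq hu r
  set d := ‖1 - u‖ ^ 2 with hd
  have hd0 : 0 ≤ d := by positivity
  have h4 : (r * u / (1 - r * u) ^ 2).re ≤ r / ((1 - r) ^ 2 + r * d) := by
    refine (Complex.re_le_norm _).trans_eq ?_
    rw [norm_div, norm_pow, hsq, norm_mul, hu, mul_one, Complex.norm_real,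
      Real.norm_of_nonneg hr0]
  have hp1 : 0 < (1 - r) ^ 2 := by nlinarith
  have hp2 : 0 < (1 - r) ^ 2 + r * d := by nlinarith [mul_nonneg hr0 hd0]
  have : 2 * r ^ 2 * d / ((1 - r) ^ 2 * ((1 - r) ^ 2 + r * d)) =
      2 * (r / (1 - r) ^ 2) - 2 * (r / ((1 - r) ^ 2 + r * d)) := by
    rw [← mul_sub, div_sub_div _ _ hp1.ne' hp2.ne']
    ring
  linarith

lemma le_tsum_regDistSq {A : ℕ} (hA : 2 ≤ A) {t θ : ℝ} (ht0 : 0 < t) (ht : t ≤ 1 / 2)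
    (hθ : |θ| ≤ Real.pi) :
    θ ^ 2 / (16 * (4 * A + 1) * t * (4 * Real.pi ^ 2 * t ^ 2 + θ ^ 2)) ≤
      ∑' m, Real.exp (-t) ^ m * regDistSq A (Complex.exp (θ * Complex.I)) m := by
  set u := Complex.exp (θ * Complex.I) with hu_def
  have hu : ‖u‖ = 1 := Complex.norm_exp_ofReal_mul_I θ
  set ρ := Real.exp (-t) with hρ
  have hρ0 : 0 ≤ ρ := (Real.exp_pos _).le
  have hρ1 : ρ < 1 := by rw [hρ]; simpa using ht0
  have hρt : 1 - ρ ≤ t := by linarith [Real.add_one_le_exp (-t)]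
  have hρt' : t / 2 ≤ 1 - ρ := by
    have h1 : 1 + t ≤ Real.exp t := by linarith [Real.add_one_le_exp t]
    have h2 : Real.exp t * ρ = 1 := by rw [hρ, ← Real.exp_add]; simp
    nlinarith
  set S := ∑' m, ρ ^ m * regDistSq A u m
  have h := (le_tsum_nat_mul hu (r := ρ ^ 2) (by positivity) (by nlinarith)).trans
    (tsum_nat_mul_le hA hu hρ0 hρ1)
  set d := ‖1 - u‖ ^ 2 with hd
  have hdθ : 4 * θ ^ 2 / Real.pi ^ 2 ≤ d := by
    have h1 : d = 2 - 2 * Real.cos θ := by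
      rw [hd, hu_def, Complex.sq_norm, Complex.normSq_apply]
      simp only [Complex.sub_re, Complex.sub_im, Complex.one_re, Complex.one_im,
        Complex.exp_ofReal_mul_I_re, Complex.exp_ofReal_mul_I_im]
      linear_combination Real.sin_sq_add_cos_sq θ
    have h2 := Real.cos_le_one_sub_mul_cos_sq hθ
    rw [h1]
    have h3 : 4 * θ ^ 2 / Real.pi ^ 2 = 2 * (2 / Real.pi ^ 2 * θ ^ 2) := by ring
    linarith
  have hpi := Real.pi_pos
  have hd0 : 0 ≤ d := by positivity
  set r := ρ ^ 2 with hr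
  have hr1 : r < 1 := by nlinarith
  have hr4 : 1 / 4 ≤ r := by nlinarith
  have hX0 : 0 < (1 - r) ^ 2 := by nlinarith
  have hX : (1 - r) ^ 2 ≤ 4 * t ^ 2 := by
    have : 1 - r ≤ 2 * t := by nlinarith
    nlinarith
  set X := (1 - r) ^ 2
  have hY : θ ^ 2 / Real.pi ^ 2 ≤ r * d := by
    have : θ ^ 2 / Real.pi ^ 2 = 1 / 4 * (4 * θ ^ 2 / Real.pi ^ 2) := by ring
    rw [this]
    exact mul_le_mul hr4 hdθ (by positivity) (by linarith)
  have hYd : 0 ≤ r * d := le_trans (by positivity) hY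
  have hQ : θ ^ 2 / (4 * Real.pi ^ 2 * t ^ 2 + θ ^ 2) ≤ r * d / (X + r * d) := by
    rw [div_le_div_iff₀ (by positivity) (by positivity)]
    rw [div_le_iff₀ (by positivity)] at hY
    have h1 : θ ^ 2 * X ≤ θ ^ 2 * (4 * t ^ 2) := mul_le_mul_of_nonneg_left hX (sq_nonneg θ)
    have h2 : θ ^ 2 * t ^ 2 ≤ r * d * Real.pi ^ 2 * t ^ 2 :=
      mul_le_mul_of_nonneg_right hY (sq_nonneg t)
    nlinarith
  have hP : 1 / (16 * t ^ 2) ≤ r / X := by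
    rw [div_le_div_iff₀ (by positivity) hX0]
    nlinarith [mul_le_mul_of_nonneg_right hr4 (sq_nonneg t)]
  have hrw : 2 * r ^ 2 * d / (X * (X + r * d)) = 2 * (r / X) * (r * d / (X + r * d)) := by
    rw [mul_assoc 2 (r / X), div_mul_div_comm, ← mul_div_assoc]
    ring
  set Q := θ ^ 2 / (4 * Real.pi ^ 2 * t ^ 2 + θ ^ 2) with hQ_def
  have hQ0 : 0 ≤ Q := by positivity
  rw [hrw, le_mul_inv_iff₀ (by linarith)] at h
  have hA0 : (0 : ℝ) < 4 * A + 1 := by positivity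
  have hgoal : θ ^ 2 / (16 * (4 * A + 1) * t * (4 * Real.pi ^ 2 * t ^ 2 + θ ^ 2)) =
      2 * (1 / (16 * t ^ 2)) * Q * (t / 2) / (4 * A + 1) := by
    rw [hQ_def]
    field_simp
  rw [hgoal, div_le_iff₀ hA0, mul_comm S]
  refine le_trans ?_ h
  have h3 := mul_le_mul hP hQ hQ0 (le_trans (by positivity) hP)
  exact mul_le_mul (by linarith) hρt' (by positivity)
    (by have : 0 ≤ r / X := le_trans (by positivity) hP
        positivity)

/-- Decay of the generating function on the circle of radius `exp (-t)` away from its real point. -/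
lemma norm_exactFn_exp_le {A : ℕ} (hA : 2 ≤ A) (k : ℕ) {t θ : ℝ} (ht0 : 0 < t) (ht : t ≤ 1 / 2)
    (hθ : |θ| ≤ Real.pi) :
    ‖exactFn A k (Complex.exp (-(t - θ * Complex.I)))‖ ≤ ‖exactFn A k (Complex.exp (-t))‖ *
      Real.exp (-(θ ^ 2 / (160 * (4 * A + 1) * t * (4 * Real.pi ^ 2 * t ^ 2 + θ ^ 2)))) := by
  have h := norm_exactFn_le (A := A) (by omega) k (Complex.norm_exp_ofReal_mul_I θ)
    (Real.exp_pos (-t)).le (by simpa using ht0)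
  have h2 := le_tsum_regDistSq hA ht0 ht hθ
  have he : Complex.exp (-(t - θ * Complex.I)) =
      (Real.exp (-t) : ℂ) * Complex.exp (θ * Complex.I) := by
    push_cast
    rw [← Complex.exp_add]
    ring_nf
  rw [he]
  push_cast at h ⊢
  refine h.trans (mul_le_mul_of_nonneg_left (Real.exp_le_exp.2 ?_) (norm_nonneg _))
  have : θ ^ 2 / (160 * (4 * A + 1) * t * (4 * Real.pi ^ 2 * t ^ 2 + θ ^ 2)) =
      θ ^ 2 / (16 * (4 * A + 1) * t * (4 * Real.pi ^ 2 * t ^ 2 + θ ^ 2)) / 10 := by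
    rw [div_div]
    ring_nf
  rw [this]
  linarith

/-- A uniform integrable bound for the integrand of the saddle point method. -/
lemma exists_exp_neg_le_inv_one_add_sq {a b : ℝ} (ha : 0 < a) (hb : 0 < b) :
    ∃ C, 0 ≤ C ∧ ∀ t u : ℝ, 0 < t → t ^ 3 * u ^ 2 ≤ b →
      Real.exp (-(a * u ^ 2 / (b + t * u ^ 2))) ≤ C * (1 + u ^ 2)⁻¹ := by
  refine ⟨1 + 2 * b / a + b * (6 * (2 / a) ^ 3), by positivity, fun t u ht htu => ?_⟩
  rw [← div_eq_mul_inv, le_div_iff₀ (by positivity)]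
  set y := a * u ^ 2 / (b + t * u ^ 2) with hy
  have hy0 : 0 ≤ y := by positivity
  have he1 : Real.exp (-y) ≤ 1 := by simpa using hy0
  have hinv : Real.exp y * Real.exp (-y) = 1 := by rw [← Real.exp_add]; simp
  have hpos := Real.exp_pos (-y)
  suffices h : u ^ 2 * Real.exp (-y) ≤ 2 * b / a + b * (6 * (2 / a) ^ 3) by linarith
  rcases le_total (t * u ^ 2) b with h | h
  · have h1 : a * u ^ 2 / (2 * b) ≤ y := by
      rw [hy]
      gcongr
      linarith
    have h2 : y * Real.exp (-y) ≤ 1 := by nlinarith [Real.add_one_le_exp y]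
    have h3 : u ^ 2 ≤ 2 * b / a * y := by
      calc u ^ 2 = 2 * b / a * (a * u ^ 2 / (2 * b)) := by field_simp
        _ ≤ _ := by gcongr
    calc u ^ 2 * Real.exp (-y) ≤ 2 * b / a * y * Real.exp (-y) := by gcongr
      _ = 2 * b / a * (y * Real.exp (-y)) := by ring
      _ ≤ 2 * b / a * 1 := by gcongr
      _ ≤ _ := by rw [mul_one]; exact le_add_of_nonneg_right (by positivity)
  · have h1 : a / (2 * t) ≤ y := by
      rw [hy, div_le_div_iff₀ (by positivity) (by positivity)]
      nlinarith
    have h2 : y ^ 3 * Real.exp (-y) ≤ 6 := by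
      have := Real.pow_div_factorial_le_exp y hy0 3
      norm_num [Nat.factorial] at this
      nlinarith
    have h3 : 1 ≤ 2 / a * t * y := by
      calc (1 : ℝ) = 2 / a * t * (a / (2 * t)) := by field_simp
        _ ≤ _ := by gcongr
    have h4 : u ^ 2 ≤ b * ((2 / a) ^ 3 * y ^ 3) := by
      have h5 : 1 ≤ (2 / a * t * y) ^ 3 := one_le_pow₀ h3
      have h6 : u ^ 2 * 1 ≤ u ^ 2 * (2 / a * t * y) ^ 3 := by gcongr
      calc u ^ 2 ≤ u ^ 2 * (2 / a * t * y) ^ 3 := by linarith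
        _ = t ^ 3 * u ^ 2 * ((2 / a) ^ 3 * y ^ 3) := by ring
        _ ≤ _ := by gcongr
    calc u ^ 2 * Real.exp (-y) ≤ b * ((2 / a) ^ 3 * y ^ 3) * Real.exp (-y) := by gcongr
      _ = b * (2 / a) ^ 3 * (y ^ 3 * Real.exp (-y)) := by ring
      _ ≤ b * (2 / a) ^ 3 * 6 := by gcongr
      _ = b * (6 * (2 / a) ^ 3) := by ring
      _ ≤ _ := le_add_of_nonneg_left (by positivity)

lemma integral_exp_int_mul_I (m : ℤ) :
    ∫ θ in -Real.pi..Real.pi, Complex.exp (m * Complex.I * θ) =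
      if m = 0 then 2 * (Real.pi : ℂ) else 0 := by
  split_ifs with h
  · simp [h, two_mul]
  · have hc : (m : ℂ) * Complex.I ≠ 0 := by simp [h]
    rw [integral_exp_mul_complex hc]
    have : (m : ℂ) * Complex.I * Real.pi =
        m * Complex.I * (-Real.pi : ℝ) + m * (2 * Real.pi * Complex.I) := by
      push_cast; ring
    rw [this, Complex.exp_periodic.int_mul m]
    simp

lemma exp_neg_sub_mul_I_pow (t θ : ℝ) (m : ℕ) :
    Complex.exp (-(t - θ * Complex.I)) ^ m =
      (Real.exp (-t) ^ m : ℝ) * Complex.exp (m * Complex.I * θ) := by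
  push_cast
  rw [← Complex.exp_nat_mul, ← Complex.exp_nat_mul, ← Complex.exp_add]
  ring_nf

open PowerSeries in
lemma norm_coeff_mul_pow (F : ℕ⟦X⟧) (t θ : ℝ) (m : ℕ) :
    ‖((coeff m F : ℕ) : ℂ) * Complex.exp (-(t - θ * Complex.I)) ^ m‖ =
      (coeff m F : ℕ) * Real.exp (-t) ^ m := by
  have h : (m : ℂ) * Complex.I * θ = ((m * θ : ℝ) : ℂ) * Complex.I := by push_cast; ring
  rw [exp_neg_sub_mul_I_pow, norm_mul, norm_mul, Complex.norm_natCast, h,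
    Complex.norm_exp_ofReal_mul_I, mul_one, Complex.norm_real, Real.norm_of_nonneg (by positivity)]

open PowerSeries in
lemma EvaluatesTo.summable_coeff {F : ℕ⟦X⟧} {t θ : ℝ} {v : ℂ}
    (h : EvaluatesTo F (Complex.exp (-(t - θ * Complex.I))) v) :
    Summable fun m => ((coeff m F : ℕ) : ℝ) * Real.exp (-t) ^ m := by
  simpa only [norm_coeff_mul_pow] using h.summable.norm

open PowerSeries in
lemma EvaluatesTo.continuous_circle {F : ℕ⟦X⟧} {t : ℝ} {V : ℝ → ℂ}
    (h : ∀ θ : ℝ, EvaluatesTo F (Complex.exp (-(t - θ * Complex.I))) (V θ)) : Continuous V := by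
  have : V = fun θ : ℝ => ∑' m, ((coeff m F : ℕ) : ℂ) * Complex.exp (-(t - θ * Complex.I)) ^ m :=
    funext fun θ => (h θ).tsum_eq.symm
  rw [this]
  exact continuous_tsum (fun m => by fun_prop) (h 0).summable_coeff
    fun m θ => (norm_coeff_mul_pow F t θ m).le

open PowerSeries in
/-- Cauchy's formula for the coefficients of a power series, on the circle of radius `exp (-t)`. -/
lemma EvaluatesTo.integral_circle {F : ℕ⟦X⟧} {t : ℝ} {V : ℝ → ℂ}
    (h : ∀ θ : ℝ, EvaluatesTo F (Complex.exp (-(t - θ * Complex.I))) (V θ)) (n : ℕ) :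
    ∫ θ in -Real.pi..Real.pi, V θ * Complex.exp (-(n * Complex.I * θ)) =
      2 * Real.pi * ((coeff n F : ℕ) * Real.exp (-t) ^ n : ℝ) := by
  have hsum := (h 0).summable_coeff
  have hnorm : ∀ θ : ℝ, ‖Complex.exp (-(n * Complex.I * θ))‖ = 1 := fun θ => by
    have : -((n : ℂ) * Complex.I * θ) = ((-(n * θ) : ℝ) : ℂ) * Complex.I := by push_cast; ring
    rw [this, Complex.norm_exp_ofReal_mul_I]
  have key := intervalIntegral.hasSum_integral_of_dominated_convergence
    (μ := MeasureTheory.volume) (a := -Real.pi) (b := Real.pi)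
    (F := fun (m : ℕ) (θ : ℝ) => ((coeff m F : ℕ) : ℂ) *
      Complex.exp (-(t - θ * Complex.I)) ^ m * Complex.exp (-(n * Complex.I * θ)))
    (f := fun θ => V θ * Complex.exp (-(n * Complex.I * θ)))
    (fun m _ => (coeff m F : ℕ) * Real.exp (-t) ^ m)
    (fun m => (Continuous.aestronglyMeasurable (by fun_prop)))
    (fun m => Filter.Eventually.of_forall fun θ _ => by
      rw [norm_mul, norm_coeff_mul_pow, hnorm, mul_one])
    (Filter.Eventually.of_forall fun θ _ => hsum)
    (by simp)
    (Filter.Eventually.of_forall fun θ _ => HasSum.mul_right _ (h θ))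
  have horth : ∀ m : ℕ, ∫ θ in -Real.pi..Real.pi, ((coeff m F : ℕ) : ℂ) *
      Complex.exp (-(t - θ * Complex.I)) ^ m * Complex.exp (-(n * Complex.I * θ)) =
      if m = n then 2 * (Real.pi : ℂ) * ((coeff n F : ℕ) * Real.exp (-t) ^ n : ℝ) else 0 := by
    intro m
    have he : ∀ θ : ℝ, ((coeff m F : ℕ) : ℂ) *
        Complex.exp (-(t - θ * Complex.I)) ^ m * Complex.exp (-(n * Complex.I * θ)) =
        (((coeff m F : ℕ) * Real.exp (-t) ^ m : ℝ) : ℂ) *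
          Complex.exp (((m - n : ℤ) : ℂ) * Complex.I * θ) := by
      intro θ
      rw [exp_neg_sub_mul_I_pow, mul_assoc, mul_assoc, ← Complex.exp_add]
      push_cast
      ring_nf
    simp_rw [he]
    rw [intervalIntegral.integral_const_mul, integral_exp_int_mul_I]
    by_cases hmn : m = n
    · subst hmn
      simp [mul_comm]
    · have : (m : ℤ) - n ≠ 0 := by omega
      simp [hmn, this]
  simp_rw [horth] at key
  exact key.unique (hasSum_ite_eq n _)

open PowerSeries MeasureTheory in
/-- Cauchy's formula, rescaled so that the saddle point has bounded width. -/
lemma EvaluatesTo.integral_rescaled {F : ℕ⟦X⟧} {t x : ℝ} (hx : 0 < x) {V : ℝ → ℂ}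
    (h : ∀ θ : ℝ, EvaluatesTo F (Complex.exp (-(t - θ * Complex.I))) (V θ)) (n : ℕ) :
    ∫ u, (Set.Ioc (-(Real.pi / x)) (Real.pi / x)).indicator
        (fun u : ℝ => V (x * u) * Complex.exp (-(n * Complex.I * (x * u : ℝ)))) u =
      2 * Real.pi * ((coeff n F : ℕ) * Real.exp (-t) ^ n : ℝ) / x := by
  have hpi := Real.pi_pos
  rw [integral_indicator measurableSet_Ioc, ← intervalIntegral.integral_of_le
    (by have : 0 < Real.pi / x := by positivity
        linarith),
    intervalIntegral.integral_comp_mul_left (fun θ : ℝ => V θ *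
      Complex.exp (-(n * Complex.I * θ))) hx.ne', mul_neg, mul_div_cancel₀ _ hx.ne',
    EvaluatesTo.integral_circle h n]
  rw [Complex.real_smul, Complex.ofReal_inv]
  ring

/-- The integrand of the saddle point method, normalised by the size of its maximum. -/
noncomputable def saddleIntegrand (A k n : ℕ) (c s u : ℝ) : ℂ :=
  (Set.Ioc (-(Real.pi / s ^ 3)) (Real.pi / s ^ 3)).indicator (fun u : ℝ =>
    exactFn A k (Complex.exp (-((s ^ 2 : ℝ) - (s ^ 3 * u : ℝ) * Complex.I))) *
      Complex.exp (-(n * Complex.I * (s ^ 3 * u : ℝ)))) u *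
    ((s ^ 2) ^ k * Real.exp (-(c / s ^ 2)) : ℝ)

lemma norm_exp_circle_lt_one {t : ℝ} (ht : 0 < t) (θ : ℝ) :
    ‖Complex.exp (-(t - θ * Complex.I))‖ < 1 :=
  norm_exp_neg_lt_one (by simpa using ht)

lemma integral_saddleIntegrand {A : ℕ} (hA : 0 < A) (k n : ℕ) (c : ℝ) {s : ℝ} (hs : 0 < s) :
    ∫ u, saddleIntegrand A k n c s u =
      (2 * Real.pi * ((PowerSeries.coeff n (exactPS A k) : ℕ) * Real.exp (-(s ^ 2)) ^ n) / s ^ 3 *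
        ((s ^ 2) ^ k * Real.exp (-(c / s ^ 2))) : ℝ) := by
  unfold saddleIntegrand
  have h := EvaluatesTo.integral_rescaled (F := exactPS A k) (t := s ^ 2) (x := s ^ 3)
    (by positivity) (fun θ => evaluatesTo_exactPS hA k
      (norm_exp_circle_lt_one (by positivity : 0 < s ^ 2) θ)) n
  rw [MeasureTheory.integral_mul_const, h]
  push_cast
  rfl

lemma aestronglyMeasurable_saddleIntegrand {A : ℕ} (hA : 0 < A) (k n : ℕ) (c : ℝ) {s : ℝ}
    (hs : 0 < s) :
    MeasureTheory.AEStronglyMeasurable (saddleIntegrand A k n c s) := by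
  have h : Continuous fun θ : ℝ =>
      exactFn A k (Complex.exp (-((s ^ 2 : ℝ) - θ * Complex.I))) :=
    EvaluatesTo.continuous_circle (F := exactPS A k) fun θ => evaluatesTo_exactPS hA k
      (norm_exp_circle_lt_one (by positivity : 0 < s ^ 2) θ)
  have h2 : Continuous fun u : ℝ =>
      exactFn A k (Complex.exp (-((s ^ 2 : ℝ) - (s ^ 3 * u : ℝ) * Complex.I))) *
      Complex.exp (-(n * Complex.I * (s ^ 3 * u : ℝ))) :=
    (h.comp (by fun_prop : Continuous fun u : ℝ => s ^ 3 * u)).mul (by fun_prop)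
  exact ((h2.aestronglyMeasurable.indicator measurableSet_Ioc).mul_const _)

lemma norm_saddleIntegrand_le {A : ℕ} (hA : 2 ≤ A) (k : ℕ) :
    ∃ C, 0 ≤ C ∧ ∀ (n : ℕ) (c s u : ℝ), 0 < s → s ^ 2 ≤ 1 / 2 → ‖saddleIntegrand A k n c s u‖ ≤
      ‖exactFn A k (Complex.exp (-(s ^ 2 : ℝ)))‖ * ((s ^ 2) ^ k * Real.exp (-(c / s ^ 2))) *
        (C * (1 + u ^ 2)⁻¹) := by
  have hpi := Real.pi_pos
  obtain ⟨C, hC0, hC⟩ := exists_exp_neg_le_inv_one_add_sq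
    (a := (160 * (4 * A + 1) : ℝ)⁻¹) (b := 4 * Real.pi ^ 2) (by positivity) (by positivity)
  refine ⟨C, hC0, fun n c s u hs hs2 => ?_⟩
  unfold saddleIntegrand
  rw [norm_mul, Complex.norm_real, Real.norm_of_nonneg (by positivity : 0 ≤ (s ^ 2) ^ k *
    Real.exp (-(c / s ^ 2))), mul_right_comm]
  refine mul_le_mul_of_nonneg_right ?_ (by positivity)
  by_cases hu : u ∈ Set.Ioc (-(Real.pi / s ^ 3)) (Real.pi / s ^ 3)
  · have hs3 : 0 < s ^ 3 := by positivity
    have hθ : |s ^ 3 * u| ≤ Real.pi := by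
      rw [abs_mul, abs_of_pos hs3, mul_comm, ← le_div_iff₀ hs3]
      exact abs_le.2 ⟨hu.1.le, hu.2⟩
    have h3 : (s ^ 2) ^ 3 * u ^ 2 ≤ 4 * Real.pi ^ 2 := by
      calc (s ^ 2) ^ 3 * u ^ 2 = |s ^ 3 * u| ^ 2 := by rw [sq_abs]; ring
        _ ≤ Real.pi ^ 2 := by gcongr
        _ ≤ _ := by linarith [sq_nonneg Real.pi]
    have hn : -((n : ℂ) * Complex.I * (s ^ 3 * u : ℝ)) =
        ((-(n * (s ^ 3 * u)) : ℝ) : ℂ) * Complex.I := by push_cast; ring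
    rw [Set.indicator_of_mem hu, norm_mul, hn, Complex.norm_exp_ofReal_mul_I, mul_one]
    refine (norm_exactFn_exp_le hA k (by positivity : 0 < s ^ 2) hs2 hθ).trans ?_
    refine mul_le_mul_of_nonneg_left ?_ (norm_nonneg _)
    refine le_of_eq_of_le ?_ (hC (s ^ 2) u (by positivity) h3)
    congr 2
    field_simp
  · rw [Set.indicator_of_notMem hu, norm_zero]
    positivity

open Filter Topology in
lemma tendsto_saddleIntegrand {A : ℕ} (hA : 0 < A) (k : ℕ) {s : ℕ → ℝ}
    (hs0 : ∀ᶠ n in atTop, 0 < s n) (hs : Tendsto s atTop (𝓝 0))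
    (hn : ∀ᶠ n : ℕ in atTop, n * s n ^ 4 = Real.pi ^ 2 / 6 * (1 - 1 / A)) (u : ℝ) :
    Tendsto (fun n => saddleIntegrand A k n (Real.pi ^ 2 / 6 * (1 - 1 / A)) (s n) u) atTop
      (𝓝 ((Real.sqrt A : ℂ)⁻¹ * (∏ j ∈ range k, ((A * (j + 1) : ℕ) : ℂ)⁻¹) *
        Complex.exp (-((Real.pi ^ 2 / 6 * (1 - 1 / A) : ℝ) * u ^ 2)))) := by
  set c := Real.pi ^ 2 / 6 * (1 - 1 / (A : ℝ))
  have hpi := Real.pi_pos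
  have hs' : Tendsto s atTop (𝓝[>] 0) := tendsto_nhdsWithin_iff.2 ⟨hs, hs0⟩
  set z : ℕ → ℂ := fun n => (s n ^ 2 : ℝ) - (s n ^ 3 * u : ℝ) * Complex.I with hz
  set w : ℕ → ℂ := fun n => 1 - (s n * u : ℝ) * Complex.I with hw
  have hzw : ∀ n, z n = (s n ^ 2 : ℝ) * w n := fun n => by
    simp only [hz, hw]; push_cast; ring
  have hw1 : Tendsto w atTop (𝓝 1) := by
    have : Continuous fun x : ℝ => 1 - ((x * u : ℝ) : ℂ) * Complex.I := by fun_prop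
    have h := (this.tendsto 0).comp hs
    simpa [Function.comp_def, hw] using h
  have hw0 : ∀ n, w n ≠ 0 := fun n h => by
    have := congrArg Complex.re h
    simp [hw] at this
  have hz0 : Tendsto z atTop (𝓝 0) := by
    have : Continuous fun x : ℝ => ((x ^ 2 : ℝ) : ℂ) - (x ^ 3 * u : ℝ) * Complex.I := by fun_prop
    have h := (this.tendsto 0).comp hs
    simpa [Function.comp_def, hz] using h
  have hinv : Tendsto (fun n => ((z n)⁻¹).re) atTop atTop := by
    have h1 : Tendsto (fun n => (s n ^ 2)⁻¹) atTop atTop :=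
      ((tendsto_pow_atTop two_ne_zero).comp (tendsto_inv_nhdsGT_zero.comp hs')).congr
        fun n => by simp
    have h2 : Tendsto (fun n => ((w n)⁻¹).re) atTop (𝓝 1) := by
      have := (Complex.continuous_re.tendsto _).comp (hw1.inv₀ one_ne_zero)
      simpa [Function.comp_def] using this
    refine (h1.atTop_mul_pos one_pos h2).congr fun n => ?_
    rw [hzw, mul_inv, ← Complex.ofReal_inv, Complex.re_ofReal_mul]
  have hpos : ∀ᶠ n in atTop, 0 < (z n).re := by
    filter_upwards [hs0] with n h
    simp only [hz, Complex.sub_re, Complex.ofReal_re, Complex.re_ofReal_mul, Complex.I_re, mul_zero,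
      sub_zero]
    positivity
  have hmain := tendsto_exactFn hA k hpos hz0 hinv
  have hwk : Tendsto (fun n => ((w n)⁻¹) ^ k) atTop (𝓝 1) := by
    simpa using (hw1.inv₀ one_ne_zero).pow k
  have hexp : Tendsto (fun n => Complex.exp (-((c : ℂ) * u ^ 2 * (w n)⁻¹))) atTop
      (𝓝 (Complex.exp (-((c : ℂ) * u ^ 2)))) := by
    refine (Complex.continuous_exp.tendsto _).comp ?_
    simpa using ((hw1.inv₀ one_ne_zero).const_mul ((c : ℂ) * u ^ 2)).neg
  have hmem : ∀ᶠ n in atTop, u ∈ Set.Ioc (-(Real.pi / s n ^ 3)) (Real.pi / s n ^ 3) := by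
    have h : Tendsto (fun n => s n ^ 3 * |u|) atTop (𝓝 0) := by
      simpa using (hs.pow 3).mul_const |u|
    filter_upwards [h.eventually_lt_const hpi, hs0] with n h1 h2
    have h3 : |u| < Real.pi / s n ^ 3 := by
      rw [lt_div_iff₀ (by positivity), mul_comm]; exact h1
    exact ⟨(abs_lt.1 h3).1, (abs_lt.1 h3).2.le⟩
  have hlim := (hmain.mul hwk).mul hexp
  rw [mul_one] at hlim
  refine hlim.congr' ?_
  filter_upwards [hmem, hs0, hn] with n h1 h2 h3
  unfold saddleIntegrand
  rw [Set.indicator_of_mem h1]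
  have hsC : (s n : ℂ) ≠ 0 := by exact_mod_cast h2.ne'
  have h3C : (n : ℂ) = c / s n ^ 4 := by
    rw [eq_div_iff (by positivity)]
    exact_mod_cast h3
  have hzk : z n ^ k * ((w n)⁻¹) ^ k = ((s n ^ 2) ^ k : ℝ) := by
    rw [← mul_pow, hzw, mul_assoc, mul_inv_cancel₀ (hw0 n), mul_one]
    push_cast; rfl
  have he : Complex.exp (-(c / z n)) * Complex.exp (-((c : ℂ) * u ^ 2 * (w n)⁻¹)) =
      Complex.exp (-(n * Complex.I * (s n ^ 3 * u : ℝ))) * Real.exp (-(c / s n ^ 2)) := by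
    rw [Complex.ofReal_exp, ← Complex.exp_add, ← Complex.exp_add, hzw, h3C]
    congr 1
    have hwn : w n = 1 - s n * u * Complex.I := by simp [hw]
    have := hw0 n
    push_cast
    field_simp
    rw [hwn]
    ring_nf
    rw [Complex.I_sq]
    ring
  calc _ = exactFn A k (Complex.exp (-z n)) * (z n ^ k * ((w n)⁻¹) ^ k) *
        (Complex.exp (-(c / z n)) * Complex.exp (-((c : ℂ) * u ^ 2 * (w n)⁻¹))) := by ring
    _ = _ := by
      rw [hzk, he]
      push_cast
      simp only [hz]
      push_cast
      ring

open Filter Topology MeasureTheory in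
lemma tendsto_integral_saddleIntegrand {A : ℕ} (hA : 2 ≤ A) (k : ℕ) {s : ℕ → ℝ}
    (hs0 : ∀ᶠ n in atTop, 0 < s n) (hs : Tendsto s atTop (𝓝 0))
    (hn : ∀ᶠ n : ℕ in atTop, n * s n ^ 4 = Real.pi ^ 2 / 6 * (1 - 1 / A)) :
    Tendsto (fun n => ∫ u, saddleIntegrand A k n (Real.pi ^ 2 / 6 * (1 - 1 / A)) (s n) u) atTop
      (𝓝 ((Real.sqrt A : ℂ)⁻¹ * (∏ j ∈ range k, ((A * (j + 1) : ℕ) : ℂ)⁻¹) *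
        Real.sqrt (Real.pi / (Real.pi ^ 2 / 6 * (1 - 1 / A))))) := by
  have hA0 : 0 < A := by omega
  set c := Real.pi ^ 2 / 6 * (1 - 1 / (A : ℝ))
  have hreal : Tendsto (fun n => exactFn A k (Complex.exp (-(s n ^ 2 : ℝ))) * (s n ^ 2 : ℝ) ^ k *
      Complex.exp (-((c : ℝ) / (s n ^ 2 : ℝ)))) atTop
      (𝓝 ((Real.sqrt A : ℂ)⁻¹ * ∏ j ∈ range k, ((A * (j + 1) : ℕ) : ℂ)⁻¹)) := by
    refine tendsto_exactFn hA0 k ?_ ?_ ?_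
    · filter_upwards [hs0] with n h
      rw [Complex.ofReal_re]
      positivity
    · have : Continuous fun x : ℝ => ((x ^ 2 : ℝ) : ℂ) := by fun_prop
      have h := (this.tendsto 0).comp hs
      simpa [Function.comp_def] using h
    · have hs' : Tendsto s atTop (𝓝[>] 0) := tendsto_nhdsWithin_iff.2 ⟨hs, hs0⟩
      refine ((tendsto_pow_atTop two_ne_zero).comp (tendsto_inv_nhdsGT_zero.comp hs')).congr
        fun n => ?_
      rw [← Complex.ofReal_inv, Complex.ofReal_re]
      simp
  obtain ⟨C, hC0, hC⟩ := norm_saddleIntegrand_le hA k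
  set M := ‖(Real.sqrt A : ℂ)⁻¹ * ∏ j ∈ range k, ((A * (j + 1) : ℕ) : ℂ)⁻¹‖ + 1
  have hM := hreal.norm.eventually_lt_const (lt_add_one _)
  have hs2 : ∀ᶠ n in atTop, s n ^ 2 < 1 / 2 :=
    (by simpa using hs.pow 2 : Tendsto (fun n => s n ^ 2) atTop (𝓝 0)).eventually_lt_const
      (by norm_num)
  have hgauss : ∫ u : ℝ, (Real.sqrt A : ℂ)⁻¹ * (∏ j ∈ range k, ((A * (j + 1) : ℕ) : ℂ)⁻¹) *
      Complex.exp (-((c : ℂ) * u ^ 2)) = (Real.sqrt A : ℂ)⁻¹ *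
      (∏ j ∈ range k, ((A * (j + 1) : ℕ) : ℂ)⁻¹) * Real.sqrt (Real.pi / c) := by
    rw [integral_const_mul, ← integral_gaussian c, ← integral_complex_ofReal]
    simp
  rw [← hgauss]
  refine tendsto_integral_filter_of_dominated_convergence
    (fun u => M * (C * (1 + u ^ 2)⁻¹)) ?_ ?_ ((integrable_inv_one_add_sq.const_mul C).const_mul M)
    (Eventually.of_forall fun u => tendsto_saddleIntegrand hA0 k hs0 hs hn u)
  · filter_upwards [hs0] with n h
    exact aestronglyMeasurable_saddleIntegrand hA0 k n c h
  · filter_upwards [hs0, hs2, hM] with n h1 h2 h3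
    refine Eventually.of_forall fun u => (hC n c (s n) u h1 h2.le).trans ?_
    refine mul_le_mul_of_nonneg_right ?_ (by positivity)
    refine le_of_eq_of_le ?_ h3.le
    rw [norm_mul, norm_mul, mul_assoc, norm_pow, Complex.norm_real,
      Real.norm_of_nonneg (by positivity), Complex.norm_exp]
    congr 3
    rw [← Complex.ofReal_div, ← Complex.ofReal_neg, Complex.ofReal_re]

open Filter Topology in
/-- The asymptotic behaviour of the coefficients of `exactPS A k`. -/
lemma tendsto_coeff_exactPS {A : ℕ} (hA : 2 ≤ A) (k : ℕ) {s : ℕ → ℝ}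
    (hs0 : ∀ᶠ n in atTop, 0 < s n) (hs : Tendsto s atTop (𝓝 0))
    (hn : ∀ᶠ n : ℕ in atTop, n * s n ^ 4 = Real.pi ^ 2 / 6 * (1 - 1 / A)) :
    Tendsto (fun n => ((PowerSeries.coeff n (exactPS A k) : ℕ) : ℝ) *
        (2 * Real.pi * Real.exp (-(2 * (Real.pi ^ 2 / 6 * (1 - 1 / A)) / s n ^ 2)) *
          (s n ^ 2) ^ k / s n ^ 3)) atTop
      (𝓝 ((Real.sqrt A)⁻¹ * (A ^ k * k.factorial : ℝ)⁻¹ *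
        Real.sqrt (Real.pi / (Real.pi ^ 2 / 6 * (1 - 1 / A))))) := by
  have h := (Complex.continuous_re.tendsto _).comp (tendsto_integral_saddleIntegrand hA k hs0 hs hn)
  set c := Real.pi ^ 2 / 6 * (1 - 1 / (A : ℝ))
  have hprod : ∏ j ∈ range k, ((A * (j + 1) : ℕ) : ℂ)⁻¹ = ((A ^ k * k.factorial : ℝ)⁻¹ : ℝ) := by
    rw [Finset.prod_inv_distrib, ← Finset.prod_range_add_one_eq_factorial]
    push_cast
    rw [Finset.prod_mul_distrib, Finset.prod_const, Finset.card_range]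
  rw [hprod, ← Complex.ofReal_inv, ← Complex.ofReal_mul, ← Complex.ofReal_mul,
    Complex.ofReal_re] at h
  refine h.congr' ?_
  filter_upwards [hs0, hn] with n h1 h2
  rw [Function.comp_apply, integral_saddleIntegrand (by omega) k n c h1, Complex.ofReal_re]
  have he : Real.exp (-(2 * c / s n ^ 2)) =
      Real.exp (-(s n ^ 2)) ^ n * Real.exp (-(c / s n ^ 2)) := by
    rw [← Real.exp_nat_mul, ← Real.exp_add, ← h2]
    congr 1
    field_simp
    ring
  rw [he]
  ring

/-- The leading term of `pexact`, at an argument parametrised by the scale of the saddle point. -/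
lemma leading_term_mul_eq {β s a : ℝ} (hβ : 0 < β) (hs : 0 < s) (ha : 0 < a) (k : ℕ) :
    (24 : ℝ) ^ ((k : ℝ) / 2 - 1 / 4) * (Real.pi ^ 2 / 6 * β / s ^ 4) ^ ((k : ℝ) / 2 - 3 / 4) /
        (Real.sqrt 2 * β ^ ((k : ℝ) / 2 - 1 / 4) * (k.factorial : ℝ) * a ^ ((k : ℝ) + 1 / 2) *
          (2 * Real.pi) ^ k) *
        Real.exp (2 * Real.pi * Real.sqrt (1 / 6 * β * (Real.pi ^ 2 / 6 * β / s ^ 4))) *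
      (2 * Real.pi * Real.exp (-(2 * (Real.pi ^ 2 / 6 * β) / s ^ 2)) * (s ^ 2) ^ k / s ^ 3) =
      (Real.sqrt a)⁻¹ * (a ^ k * k.factorial : ℝ)⁻¹ *
        Real.sqrt (Real.pi / (Real.pi ^ 2 / 6 * β)) := by
  have hpi := Real.pi_pos
  have hexp : 2 * Real.pi * Real.sqrt (1 / 6 * β * (Real.pi ^ 2 / 6 * β / s ^ 4)) =
      2 * (Real.pi ^ 2 / 6 * β) / s ^ 2 := by
    have : 1 / 6 * β * (Real.pi ^ 2 / 6 * β / s ^ 4) = (Real.pi * β / (6 * s ^ 2)) ^ 2 := by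
      field_simp
    rw [this, Real.sqrt_sq (by positivity)]
    field_simp
  have h24 : (24 : ℝ) ^ ((k : ℝ) / 2 - 1 / 4) * (Real.pi ^ 2 / 6 * β) ^ ((k : ℝ) / 2 - 1 / 4) =
      (2 * Real.pi) ^ k / (Real.sqrt 2 * Real.sqrt Real.pi) * β ^ ((k : ℝ) / 2 - 1 / 4) := by
    rw [← Real.mul_rpow (by norm_num) (by positivity),
      show 24 * (Real.pi ^ 2 / 6 * β) = (2 * Real.pi) ^ 2 * β by ring,
      Real.mul_rpow (by positivity) hβ.le, ← Real.rpow_natCast (2 * Real.pi) 2,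
      ← Real.rpow_mul (by positivity), ← Real.sqrt_mul (by norm_num), Real.sqrt_eq_rpow,
      ← Real.rpow_natCast (2 * Real.pi) k, ← Real.rpow_sub (by positivity)]
    congr 2
    push_cast
    ring
  have hc : 0 < Real.pi ^ 2 / 6 * β := by positivity
  have hx : (Real.pi ^ 2 / 6 * β / s ^ 4) ^ ((k : ℝ) / 2 - 3 / 4) =
      (Real.pi ^ 2 / 6 * β) ^ ((k : ℝ) / 2 - 1 / 4) / Real.sqrt (Real.pi ^ 2 / 6 * β) /
        ((s ^ 2) ^ k / s ^ 3) := by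
    rw [Real.div_rpow hc.le (by positivity), Real.sqrt_eq_rpow, ← Real.rpow_sub hc,
      ← Real.rpow_natCast s 4, ← Real.rpow_mul hs.le, ← pow_mul, ← Real.rpow_natCast s 3,
      ← Real.rpow_natCast s (2 * k), ← Real.rpow_sub hs]
    congr 2
    · ring
    · push_cast
      ring
  have haa : a ^ ((k : ℝ) + 1 / 2) = a ^ k * Real.sqrt a := by
    rw [Real.rpow_add ha, Real.rpow_natCast, Real.sqrt_eq_rpow]
  have hsqrt2 : Real.sqrt 2 ^ 2 = 2 := Real.sq_sqrt (by norm_num)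
  have hsqrtpi : Real.sqrt Real.pi ^ 2 = Real.pi := Real.sq_sqrt hpi.le
  have h0 : (0 : ℝ) < 24 ^ ((k : ℝ) / 2 - 1 / 4) := Real.rpow_pos_of_pos (by norm_num) _
  rw [hexp, hx, haa, Real.exp_neg, Real.sqrt_div hpi.le,
    eq_div_of_mul_eq h0.ne' ((mul_comm _ _).trans h24)]
  have h1 : 0 < Real.sqrt (Real.pi ^ 2 / 6 * β) := Real.sqrt_pos.2 hc
  have h2 : 0 < β ^ ((k : ℝ) / 2 - 1 / 4) := Real.rpow_pos_of_pos hβ _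
  have h3 : 0 < Real.sqrt a := Real.sqrt_pos.2 ha
  have h4 : (0 : ℝ) < k.factorial := by positivity
  generalize Real.sqrt (Real.pi ^ 2 / 6 * β) = x1 at *
  generalize β ^ ((k : ℝ) / 2 - 1 / 4) = x2 at *
  have h5 := Real.exp_pos (2 * (Real.pi ^ 2 / 6 * β) / s ^ 2)
  generalize Real.exp (2 * (Real.pi ^ 2 / 6 * β) / s ^ 2) = x3 at *
  have h6 : 0 < Real.sqrt Real.pi := Real.sqrt_pos.2 hpi
  field_simp
  rw [hsqrt2, hsqrtpi]

theorem stmt13 (A k : ℕ) (hA : 2 ≤ A) :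
    Filter.Tendsto
      (fun n : ℕ => (pexact A k n : ℝ) /
        ((24 : ℝ) ^ ((k : ℝ) / 2 - 1 / 4) * ((n - A * k : ℕ) : ℝ) ^ ((k : ℝ) / 2 - 3 / 4) /
          (Real.sqrt 2 * (1 - 1 / (A : ℝ)) ^ ((k : ℝ) / 2 - 1 / 4) *
            (Nat.factorial k : ℝ) * (A : ℝ) ^ ((k : ℝ) + 1 / 2) * (2 * Real.pi) ^ k) *
          Real.exp (2 * Real.pi * Real.sqrt (1 / 6 * (1 - 1 / (A : ℝ)) * ((n - A * k : ℕ) : ℝ)))))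
      Filter.atTop (nhds 1) := by
  have hA0 : 0 < A := by omega
  have hA2 : (2 : ℝ) ≤ A := by exact_mod_cast hA
  have hβ : 0 < 1 - 1 / (A : ℝ) := by
    rw [sub_pos, div_lt_one (by linarith)]
    linarith
  have hpi := Real.pi_pos
  set c := Real.pi ^ 2 / 6 * (1 - 1 / (A : ℝ)) with hc_def
  have hc : 0 < c := by positivity
  set s : ℕ → ℝ := fun n => (c / n) ^ (1 / 4 : ℝ) with hs_def
  have hs0 : ∀ n : ℕ, 0 < n → 0 < s n := fun n hn => by
    have : (0 : ℝ) < n := by exact_mod_cast hn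
    exact Real.rpow_pos_of_pos (by positivity) _
  have hs4 : ∀ n : ℕ, s n ^ 4 = c / n := fun n => by
    rw [hs_def, ← Real.rpow_natCast, ← Real.rpow_mul (by positivity)]
    norm_num
  have hn : ∀ n : ℕ, 0 < n → n * s n ^ 4 = c := fun n hn => by
    have : (n : ℝ) ≠ 0 := by exact_mod_cast hn.ne'
    rw [hs4, mul_div_cancel₀ _ this]
  have hs : Filter.Tendsto s Filter.atTop (nhds 0) := by
    have h := (tendsto_const_div_atTop_nhds_zero_nat c).rpow_const
      (p := (1 / 4 : ℝ)) (Or.inr (by norm_num))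
    rwa [Real.zero_rpow (by norm_num)] at h
  have hpos := Filter.eventually_gt_atTop (0 : ℕ)
  have hlim := tendsto_coeff_exactPS hA k (hpos.mono hs0) hs (hpos.mono hn)
  set L := (Real.sqrt A)⁻¹ * (A ^ k * k.factorial : ℝ)⁻¹ * Real.sqrt (Real.pi / c)
  have hL : 0 < L := by positivity
  have hsub := (hlim.comp (Filter.tendsto_sub_atTop_nat (A * k))).div_const L
  rw [div_self hL.ne'] at hsub
  refine hsub.congr' ?_
  filter_upwards [Filter.eventually_gt_atTop (A * k)] with n hnk
  rw [pexact_eq_coeff A k n hA0 hnk.le]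
  have hm : 0 < n - A * k := by omega
  have hm' : (0 : ℝ) < (n - A * k : ℕ) := by exact_mod_cast hm
  have key := leading_term_mul_eq hβ (hs0 _ hm) (by linarith : (0 : ℝ) < A) k
  rw [← hc_def, hs4, div_div_cancel₀ hc.ne'] at key
  simp only [Function.comp_apply]
  have hQ : 0 < 2 * Real.pi * Real.exp (-(2 * c / s (n - A * k) ^ 2)) *
      (s (n - A * k) ^ 2) ^ k / s (n - A * k) ^ 3 := by
    have := hs0 _ hm
    positivity
  change _ = L at key
  rw [← key, mul_div_mul_right _ _ hQ.ne']
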